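/- arXiv:1802.09938 — 2 statements merged into one kernel-verified Lean document; each statement's English description precedes it below -/
import Mathlib

section
/- For the restricted Yangian Y_p(gl_3) with p > 2 and every s with 2 ≤ s ≤ p+1, the subvariety W_{2s} of GTs_1 is equidimensional of dimension 3p, i.e., every irreducible component of W_{2s} has Krull dimension 3p. -/
open scoped Classical

noncomputable section



/-- The Zariski topology on affine space `σ → k`: generated by complements of
hypersurfaces. -/
def zariskiTopology (k : Type*) [CommRing k] (σ : Type*) : TopologicalSpace (σ → k) :=
  TopologicalSpace.generateFrom
    {U | ∃ f : MvPolynomial σ k, U = {x | MvPolynomial.eval x f ≠ 0}}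

/-- The irreducible components of a subset `V` of affine space, with respect to the
subspace topology induced by the Zariski topology. -/
def zComponents (k : Type*) [CommRing k] (σ : Type*) (V : Set (σ → k)) : Set (Set V) :=
  @irreducibleComponents V (TopologicalSpace.induced Subtype.val (zariskiTopology k σ))

/-- The topological Krull dimension of a subset `C` of a subset `V` of affine space
(with the topology induced from the Zariski topology). -/
def zKrullDimSub (k : Type*) [CommRing k] (σ : Type*) {V : Set (σ → k)} (C : Set V) :
    WithBot ℕ∞ :=
  @topologicalKrullDim C (TopologicalSpace.induced Subtype.val
    (TopologicalSpace.induced Subtype.val (zariskiTopology k σ)))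

/-- The topological Krull dimension of a subset of affine space with the Zariski topology. -/
def zKrullDim (k : Type*) [CommRing k] (σ : Type*) (V : Set (σ → k)) : WithBot ℕ∞ :=
  @topologicalKrullDim V (TopologicalSpace.induced Subtype.val (zariskiTopology k σ))

/-- Irreducibility of a subset of affine space with the Zariski topology. -/
def zIsIrreducible (k : Type*) [CommRing k] (σ : Type*) (V : Set (σ → k)) : Prop :=
  @IsIrreducible _ (zariskiTopology k σ) V

/-- A subset of affine space is equidimensional of dimension `d` if each of its
irreducible components (w.r.t. the Zariski topology) has Krull dimension `d`. -/
def IsEquidimOfDim (k : Type*) [CommRing k] (σ : Type*) (V : Set (σ → k)) (d : ℕ) : Prop :=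
  ∀ C ∈ zComponents k σ V, zKrullDimSub k σ C = (d : WithBot ℕ∞)




/-- The `m × m` matrix `X(u)_m` over `k[u]` attached to a point `x` of `k^{n²p}`:
its `(a,b)` entry is `δ_{ab} u^p + Σ_{t=1}^p x_{ab}^{(t)} u^{p-t}`. -/
def Xu (k : Type*) [CommRing k] (n p : ℕ) (x : Fin n × Fin n × Fin p → k)
    (m : ℕ) (hm : m ≤ n) : Matrix (Fin m) (Fin m) (Polynomial k) :=
  Matrix.of fun a b =>
    (if (a : ℕ) = (b : ℕ) then Polynomial.X ^ p else 0) +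
      ∑ t : Fin p, Polynomial.C (x (Fin.castLE hm a, Fin.castLE hm b, t)) *
        Polynomial.X ^ (p - ((t : ℕ) + 1))

/-- The value at the point `x` of the polynomial `d̄_{mj}`, defined as the coefficient of
`u^{mp-j}` in `det X(u)_m`. -/
def dbar (k : Type*) [CommRing k] (n p : ℕ) (x : Fin n × Fin n × Fin p → k) (m j : ℕ) : k :=
  if hm : m ≤ n then ((Xu k n p x m hm).det).coeff (m * p - j) else 0

/-- The Gelfand–Tsetlin variety for the restricted Yangian `Y_p(gl_n)`: the common zero
set in `k^{n²p}` of all the polynomials `d̄_{mj}` (`1 ≤ m ≤ n`, `1 ≤ j ≤ mp`). -/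
def GTsYang (k : Type*) [CommRing k] (n p : ℕ) : Set (Fin n × Fin n × Fin p → k) :=
  {x | ∀ m j : ℕ, 1 ≤ m → m ≤ n → 1 ≤ j → j ≤ m * p → dbar k n p x m j = 0}




/-- Accessor for the coordinate `X_{ab}^{(t)}` of a point of `k^{n²p}`, with `1`-based
indices `a, b ∈ {1, …, n}` and `t ∈ {1, …, p}` (and value `0` out of range). -/
def xvn (k : Type*) [CommRing k] (n p : ℕ) (x : Fin n × Fin n × Fin p → k) (a b t : ℕ) : k :=
  if h : 1 ≤ a ∧ a ≤ n ∧ 1 ≤ b ∧ b ≤ n ∧ 1 ≤ t ∧ t ≤ p then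
    x (⟨a - 1, by omega⟩, ⟨b - 1, by omega⟩, ⟨t - 1, by omega⟩) else 0

/-- The value of the polynomial `p_{1i} = X_{11}^{(i)}`. -/
def P1v (k : Type*) [CommRing k] (n p : ℕ) (x : Fin n × Fin n × Fin p → k) (i : ℕ) : k :=
  xvn k n p x 1 1 i

/-- The value of the polynomial `p_{2i}` (for `1 ≤ i ≤ 2p`). -/
def P2v (k : Type*) [CommRing k] (n p : ℕ) (x : Fin n × Fin n × Fin p → k) (i : ℕ) : k :=
  if i ≤ p then
    xvn k n p x 2 2 i - ∑ t ∈ Finset.Icc 1 (i - 1), xvn k n p x 1 2 t * xvn k n p x 2 1 (i - t)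
  else
    ∑ t ∈ Finset.Icc (i - p) p, xvn k n p x 1 2 t * xvn k n p x 2 1 (i - t)

/-- The value of
`T(r,s,m) = −X_{13}^{(r)}X_{22}^{(s)}X_{31}^{(m)} + X_{12}^{(r)}X_{23}^{(s)}X_{31}^{(m)}
 + X_{13}^{(r)}X_{21}^{(s)}X_{32}^{(m)}`. -/
def Tv (k : Type*) [CommRing k] (n p : ℕ) (x : Fin n × Fin n × Fin p → k) (r s m : ℕ) : k :=
  -(xvn k n p x 1 3 r * xvn k n p x 2 2 s * xvn k n p x 3 1 m) +
    xvn k n p x 1 2 r * xvn k n p x 2 3 s * xvn k n p x 3 1 m +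
    xvn k n p x 1 3 r * xvn k n p x 2 1 s * xvn k n p x 3 2 m

/-- The value of the polynomial `p_{3i}` (for `1 ≤ i ≤ 3p`). -/
def P3v (k : Type*) [CommRing k] (n p : ℕ) (x : Fin n × Fin n × Fin p → k) (i : ℕ) : k :=
  if i ≤ p then
    xvn k n p x 3 3 i
      - ∑ s ∈ Finset.Icc 1 (i - 1),
          (xvn k n p x 1 3 s * xvn k n p x 3 1 (i - s) +
           xvn k n p x 2 3 s * xvn k n p x 3 2 (i - s))
      - ∑ r ∈ Finset.Icc 1 (i - 2), ∑ s ∈ Finset.Icc 2 (i - r - 1),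
          xvn k n p x 1 3 r * xvn k n p x 2 2 s * xvn k n p x 3 1 (i - r - s)
      + ∑ r ∈ Finset.Icc 1 (i - 2), ∑ s ∈ Finset.Icc 1 (i - r - 1),
          (xvn k n p x 1 2 r * xvn k n p x 2 3 s * xvn k n p x 3 1 (i - r - s) +
           xvn k n p x 1 3 r * xvn k n p x 2 1 s * xvn k n p x 3 2 (i - r - s))
  else if i = p + 1 then
    - ∑ s ∈ Finset.Icc 1 p,
          (xvn k n p x 1 3 s * xvn k n p x 3 1 (p + 1 - s) +
           xvn k n p x 2 3 s * xvn k n p x 3 2 (p + 1 - s))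
      - ∑ r ∈ Finset.Icc 1 (p - 1), ∑ s ∈ Finset.Icc 2 (p - r),
          xvn k n p x 1 3 r * xvn k n p x 2 2 s * xvn k n p x 3 1 (p + 1 - r - s)
      + ∑ r ∈ Finset.Icc 1 (p - 1), ∑ s ∈ Finset.Icc 1 (p - r),
          (xvn k n p x 1 2 r * xvn k n p x 2 3 s * xvn k n p x 3 1 (p + 1 - r - s) +
           xvn k n p x 1 3 r * xvn k n p x 2 1 s * xvn k n p x 3 2 (p + 1 - r - s))
  else if i ≤ 2 * p then
    - ∑ s ∈ Finset.Icc (i - p) p,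
          (xvn k n p x 1 3 s * xvn k n p x 3 1 (i - s) +
           xvn k n p x 2 3 s * xvn k n p x 3 2 (i - s))
      + ∑ r ∈ Finset.Icc 1 (i - p - 1), ∑ s ∈ Finset.Icc (i - p - r) p,
          Tv k n p x r s (i - r - s)
      + ∑ r ∈ Finset.Icc (i - p) p, ∑ s ∈ Finset.Icc 1 (i - r - 1),
          Tv k n p x r s (i - r - s)
  else
    ∑ r ∈ Finset.Icc (i - 2 * p) p, ∑ s ∈ Finset.Icc (i - p - r) p,
      Tv k n p x r s (i - r - s)


/-- Condition `W`: all the variables `X₁₁^{(t)}, X₁₂^{(t)}, X₂₂^{(t)}` (`1 ≤ t ≤ p`)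
vanish at `x`. -/
def WZero (k : Type*) [CommRing k] (n p : ℕ) (x : Fin n × Fin n × Fin p → k) : Prop :=
  ∀ t : ℕ, 1 ≤ t → t ≤ p →
    xvn k n p x 1 1 t = 0 ∧ xvn k n p x 1 2 t = 0 ∧ xvn k n p x 2 2 t = 0

/-- Condition `D`: all the polynomials `p_{mj} = d̄_{mj}` (`4 ≤ m ≤ n`, `1 ≤ j ≤ mp`)
vanish at `x` (vacuous when `n = 3`). -/
def DZero (k : Type*) [CommRing k] (n p : ℕ) (x : Fin n × Fin n × Fin p → k) : Prop :=
  ∀ m j : ℕ, 4 ≤ m → m ≤ n → 1 ≤ j → j ≤ m * p → dbar k n p x m j = 0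

/-- Condition: `p_{3j}` vanishes at `x` for all `1 ≤ j ≤ J`. -/
def P3Zero (k : Type*) [CommRing k] (n p : ℕ) (x : Fin n × Fin n × Fin p → k) (J : ℕ) : Prop :=
  ∀ j : ℕ, 1 ≤ j → j ≤ J → P3v k n p x j = 0

/-- `GTs₁ = Z(W ∪ {p_{3j} : 1 ≤ j ≤ 3p} ∪ D)`. -/
def GTs1 (k : Type*) [CommRing k] (n p : ℕ) : Set (Fin n × Fin n × Fin p → k) :=
  {x | WZero k n p x ∧ P3Zero k n p x (3 * p) ∧ DZero k n p x}

/-- `W^p = Z(W ∪ {p_{3j} : 1 ≤ j ≤ 3p−3} ∪ {X₃₂^{(p)}, X₂₁^{(p)}, X₁₃^{(p)}} ∪ D)`. -/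
def Wtop (k : Type*) [CommRing k] (n p : ℕ) : Set (Fin n × Fin n × Fin p → k) :=
  {x | WZero k n p x ∧ P3Zero k n p x (3 * p - 3) ∧
       xvn k n p x 3 2 p = 0 ∧ xvn k n p x 2 1 p = 0 ∧ xvn k n p x 1 3 p = 0 ∧ DZero k n p x}

/-- `W_{1s}` (`1 ≤ s ≤ p+1`): the zero set of `W`, `{p_{3j} : 1 ≤ j ≤ 2p}`,
`X₁₃^{(t)}` for `s ≤ t ≤ p`, `X₂₁^{(t)}` for `p−s+2 ≤ t ≤ p`, and `D`.
(For `s = 1` the `X₂₁` conditions are vacuous; for `s = p+1` the `X₁₃` conditions are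
vacuous.) -/
def W1s (k : Type*) [CommRing k] (n p s : ℕ) : Set (Fin n × Fin n × Fin p → k) :=
  {x | WZero k n p x ∧ P3Zero k n p x (2 * p) ∧
       (∀ t : ℕ, s ≤ t → t ≤ p → xvn k n p x 1 3 t = 0) ∧
       (∀ t : ℕ, p + 2 - s ≤ t → t ≤ p → xvn k n p x 2 1 t = 0) ∧ DZero k n p x}

/-- `W₁ = ⋃_{s=1}^{p+1} W_{1s}`. -/
def W1 (k : Type*) [CommRing k] (n p : ℕ) : Set (Fin n × Fin n × Fin p → k) :=
  ⋃ s ∈ Set.Icc 1 (p + 1), W1s k n p s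

/-- `W_{2s}` (`2 ≤ s ≤ p+1`): the zero set of `W`, `{p_{3j} : 1 ≤ j ≤ 2p}`,
`X₂₁^{(t)}` for `s ≤ t ≤ p`, `X₃₂^{(t)}` for `p−s+2 ≤ t ≤ p`, and `D`.
(For `s = p+1` the `X₂₁` conditions are vacuous.) -/
def W2s (k : Type*) [CommRing k] (n p s : ℕ) : Set (Fin n × Fin n × Fin p → k) :=
  {x | WZero k n p x ∧ P3Zero k n p x (2 * p) ∧
       (∀ t : ℕ, s ≤ t → t ≤ p → xvn k n p x 2 1 t = 0) ∧
       (∀ t : ℕ, p + 2 - s ≤ t → t ≤ p → xvn k n p x 3 2 t = 0) ∧ DZero k n p x}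

/-- `W₂ = ⋃_{s=2}^{p+1} W_{2s}`. -/
def W2 (k : Type*) [CommRing k] (n p : ℕ) : Set (Fin n × Fin n × Fin p → k) :=
  ⋃ s ∈ Set.Icc 2 (p + 1), W2s k n p s

/-- `W_{3s}` (`2 ≤ s ≤ p`): the zero set of `W`, `{p_{3j} : 1 ≤ j ≤ 2p}`,
`X₁₃^{(t)}` for `s ≤ t ≤ p`, `X₃₂^{(t)}` for `p−s+2 ≤ t ≤ p`, and `D`. -/
def W3s (k : Type*) [CommRing k] (n p s : ℕ) : Set (Fin n × Fin n × Fin p → k) :=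
  {x | WZero k n p x ∧ P3Zero k n p x (2 * p) ∧
       (∀ t : ℕ, s ≤ t → t ≤ p → xvn k n p x 1 3 t = 0) ∧
       (∀ t : ℕ, p + 2 - s ≤ t → t ≤ p → xvn k n p x 3 2 t = 0) ∧ DZero k n p x}

/-- `W₃ = ⋃_{s=2}^{p} W_{3s}`. -/
def W3 (k : Type*) [CommRing k] (n p : ℕ) : Set (Fin n × Fin n × Fin p → k) :=
  ⋃ s ∈ Set.Icc 2 p, W3s k n p s

open Cardinal in
theorem aux_dim_integral {R S : Type*} [CommRing R] [CommRing S] [Algebra R S]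
    [Algebra.IsIntegral R S] (hinj : Function.Injective (algebraMap R S)) :
    ringKrullDim S = ringKrullDim R := by
  apply le_antisymm
  · refine Order.krullDim_le_of_strictMono (PrimeSpectrum.comap (algebraMap R S)) ?_
    intro P Q h
    exact Ideal.IsIntegral.comap_lt_comap (R := R) (I := P.asIdeal) (J := Q.asIdeal) h
  · refine iSup_le fun l => ?_
    obtain ⟨Q, -, hQ, hl⟩ := Ideal.exists_ideal_over_prime_of_isIntegral (S := S)
      (RelSeries.head l).asIdeal ⊥ (by
        rw [← RingHom.ker_eq_comap_bot, (RingHom.injective_iff_ker_eq_bot _).1 hinj]; exact bot_le)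
    have : Q.LiesOver (RelSeries.head l).asIdeal := ⟨hl.symm⟩
    obtain ⟨L, hL, -⟩ := Ideal.exists_ltSeries_of_hasGoingUp l Q
    rw [← hL]
    exact le_iSup (fun L : LTSeries (PrimeSpectrum S) => (L.length : WithBot ℕ∞)) L

open Cardinal in
theorem aux_dim_sandwich {k : Type*} [Field k] {A : Type*} [CommRing A] [IsDomain A] [Algebra k A]
    [Algebra.FiniteType k A] {τ : Type} [Fintype τ] (i : MvPolynomial τ k →ₐ[k] A)
    (hi : Function.Injective i) (j : A →ₐ[k] MvPolynomial τ k) (hj : Function.Injective j) :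
    ringKrullDim A = (Fintype.card τ : WithBot ℕ∞) := by
  obtain ⟨d, g, hg, hgi⟩ := exists_integral_inj_algHom_of_fg k A
  have h1 : ringKrullDim A = (d : WithBot ℕ∞) := by
    let := g.toRingHom.toAlgebra
    have : Algebra.IsIntegral (MvPolynomial (Fin d) k) A := ⟨hgi⟩
    rw [aux_dim_integral (R := MvPolynomial (Fin d) k) (S := A) hg,
      MvPolynomial.ringKrullDim_of_isNoetherianRing]
    simp
  rw [h1]
  have h2 : (d : ℕ) ≤ Fintype.card τ := by
    have := lift_trdeg_le_of_injective (j.comp g) (hj.comp hg)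
    rw [MvPolynomial.trdeg_of_isDomain, MvPolynomial.trdeg_of_isDomain] at this
    simpa using this
  have h3 : Fintype.card τ ≤ d := by
    have ht : Algebra.trdeg k A = d := by
      let := g.toRingHom.toAlgebra
      have : Algebra.IsIntegral (MvPolynomial (Fin d) k) A := ⟨hgi⟩
      have : IsScalarTower k (MvPolynomial (Fin d) k) A := IsScalarTower.of_algHom g
      have : FaithfulSMul (MvPolynomial (Fin d) k) A := (faithfulSMul_iff_algebraMap_injective _ _).2 hg
      have := lift_trdeg_add_eq k (MvPolynomial (Fin d) k) A
      rw [MvPolynomial.trdeg_of_isDomain, trdeg_eq_zero] at this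
      simpa using this.symm
    have := lift_trdeg_le_of_injective i hi
    rw [MvPolynomial.trdeg_of_isDomain, ht] at this
    simpa using this
  rw [le_antisymm h2 h3]

open MvPolynomial in
theorem aux_closed_iff {k : Type*} [Field k] {σ : Type*} (Z : Set (σ → k)) :
    @IsClosed _ (zariskiTopology k σ) Z ↔ ∃ I : Ideal (MvPolynomial σ k), Z = zeroLocus k I := by
  constructor
  · intro h
    have h' := h.isOpen_compl
    have key : ∀ U : Set (σ → k), TopologicalSpace.GenerateOpen
        {U | ∃ f : MvPolynomial σ k, U = {x | MvPolynomial.eval x f ≠ 0}} U →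
        ∃ I : Ideal (MvPolynomial σ k), Uᶜ = zeroLocus k I := by
      intro U hU
      induction hU with
      | basic s hs =>
        obtain ⟨f, rfl⟩ := hs
        refine ⟨Ideal.span {f}, ?_⟩
        rw [zeroLocus_span]
        ext x
        simp [aeval_eq_eval]
      | univ => exact ⟨⊤, by simp⟩
      | inter s t _ _ hs ht =>
        obtain ⟨I, hI⟩ := hs
        obtain ⟨J, hJ⟩ := ht
        refine ⟨I * J, ?_⟩
        rw [Set.compl_inter, hI, hJ]
        ext x
        constructor
        · rintro (hx | hx)
          · exact zeroLocus_anti_mono (Ideal.mul_le_left) hx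
          · exact zeroLocus_anti_mono (Ideal.mul_le_right) hx
        · intro hx
          by_contra hc
          simp only [Set.mem_union, not_or, mem_zeroLocus_iff, not_forall] at hc
          obtain ⟨⟨a, ha, ha'⟩, ⟨b, hb, hb'⟩⟩ := hc
          have := hx (a * b) (Ideal.mul_mem_mul ha hb)
          rw [map_mul] at this
          exact (mul_ne_zero ha' hb') this
      | sUnion S _ hS =>
        choose! I hI using hS
        refine ⟨⨆ s ∈ S, I s, ?_⟩
        rw [Set.compl_sUnion]
        have := (zeroLocus_vanishingIdeal_galoisConnection (k := k) (K := k) (σ := σ)).l_iSup₂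
          (f := fun (s : Set (σ → k)) (_ : s ∈ S) => I s)
        refine Eq.trans ?_ this.symm
        change _ = ⋂ s ∈ S, zeroLocus k (I s)
        rw [Set.sInter_image]
        exact Set.iInter₂_congr fun s hs => hI s hs
    obtain ⟨I, hI⟩ := key _ h'
    exact ⟨I, by rwa [compl_compl] at hI⟩
  · rintro ⟨I, rfl⟩
    have : zeroLocus k I = ⋂ f ∈ I, {x | eval x f ≠ 0}ᶜ := by
      ext x; simp [aeval_eq_eval]
    rw [this]
    let _ := zariskiTopology k σ
    refine isClosed_biInter fun f _ => ?_
    rw [isClosed_compl_iff]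
    exact TopologicalSpace.isOpen_generateFrom_of_mem ⟨f, rfl⟩

open MvPolynomial in
theorem aux_irred {k : Type*} [Field k] [IsAlgClosed k] {σ : Type*} [Finite σ]
    {T : Type*} [tT : TopologicalSpace T]
    (f : T → σ → k) (hf : tT = TopologicalSpace.induced f (zariskiTopology k σ))
    (Q : Ideal (MvPolynomial σ k)) [Q.IsPrime] (hr : zeroLocus k Q ⊆ Set.range f) :
    IsIrreducible (f ⁻¹' zeroLocus k Q) ∧ f '' (f ⁻¹' zeroLocus k Q) = zeroLocus k Q ∧
      IsClosed (f ⁻¹' zeroLocus k Q) := by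
  have hc : ∀ z : Set T, IsClosed z ↔ ∃ I : Ideal (MvPolynomial σ k), z = f ⁻¹' zeroLocus k I := by
    intro z
    subst hf
    rw [@isClosed_induced_iff _ _ (zariskiTopology k σ)]
    constructor
    · rintro ⟨t, ht, rfl⟩
      obtain ⟨I, rfl⟩ := (aux_closed_iff t).1 ht
      exact ⟨I, rfl⟩
    · rintro ⟨I, rfl⟩
      exact ⟨_, (aux_closed_iff _).2 ⟨I, rfl⟩, rfl⟩
  have him : f '' (f ⁻¹' zeroLocus k Q) = zeroLocus k Q := by
    rw [Set.image_preimage_eq_iff]; exact hr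
  have hv : vanishingIdeal k (zeroLocus k Q) = Q := IsPrime.vanishingIdeal_zeroLocus Q
  refine ⟨⟨?_, ?_⟩, him, (hc _).2 ⟨Q, rfl⟩⟩
  · by_contra hne
    rw [Set.not_nonempty_iff_eq_empty] at hne
    rw [hne, Set.image_empty] at him
    rw [← him, vanishingIdeal_empty] at hv
    exact Ideal.IsPrime.ne_top ‹_› hv.symm
  · rw [isPreirreducible_iff_isClosed_union_isClosed]
    intro z₁ z₂ h₁ h₂ hz
    obtain ⟨I, rfl⟩ := (hc _).1 h₁
    obtain ⟨J, rfl⟩ := (hc _).1 h₂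
    have hIJ : I * J ≤ Q := by
      rw [← hv, ← le_zeroLocus_iff_le_vanishingIdeal, ← him]
      rintro _ ⟨x, hx, rfl⟩
      rcases hz hx with h | h
      · exact zeroLocus_anti_mono (I := I * J) (J := I) (Ideal.mul_le_left) h
      · exact zeroLocus_anti_mono (I := I * J) (J := J) (Ideal.mul_le_right) h
    rcases (Ideal.IsPrime.mul_le ‹_›).1 hIJ with h | h
    · exact Or.inl (Set.preimage_mono (zeroLocus_anti_mono h))
    · exact Or.inr (Set.preimage_mono (zeroLocus_anti_mono h))

open MvPolynomial in
theorem aux_prime {k : Type*} [Field k] {σ : Type*}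
    {T : Type*} [tT : TopologicalSpace T]
    (f : T → σ → k) (hf : tT = TopologicalSpace.induced f (zariskiTopology k σ))
    (S : Set T) (hS : IsIrreducible S) : (vanishingIdeal k (f '' S)).IsPrime := by
  constructor
  · obtain ⟨x, hx⟩ := hS.1
    intro h
    have : (1 : MvPolynomial σ k) ∈ vanishingIdeal k (f '' S) := h ▸ Submodule.mem_top
    have := this (f x) ⟨x, hx, rfl⟩
    simp at this
  · intro a b hab
    have hcl : ∀ a : MvPolynomial σ k, IsClosed (f ⁻¹' (zeroLocus k (Ideal.span {a}))) := by
      intro a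
      subst hf
      rw [@isClosed_induced_iff _ _ (zariskiTopology k σ)]
      exact ⟨_, (aux_closed_iff _).2 ⟨Ideal.span {a}, rfl⟩, rfl⟩
    have := isPreirreducible_iff_isClosed_union_isClosed.1 hS.2 _ _ (hcl a) (hcl b) (by
      intro x hx
      have := hab (f x) ⟨x, hx, rfl⟩
      rw [map_mul, mul_eq_zero] at this
      simpa [zeroLocus_span] using this)
    rcases this with h | h
    · left; rintro _ ⟨x, hx, rfl⟩
      simpa [zeroLocus_span] using h hx
    · right; rintro _ ⟨x, hx, rfl⟩
      simpa [zeroLocus_span] using h hx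

open MvPolynomial in
theorem aux_topdim {k : Type*} [Field k] [IsAlgClosed k] {σ : Type*} [Finite σ]
    {T : Type*} [tT : TopologicalSpace T]
    (f : T → σ → k) (hf : tT = TopologicalSpace.induced f (zariskiTopology k σ))
    (P : Ideal (MvPolynomial σ k)) (hr : Set.range f = zeroLocus k P) :
    topologicalKrullDim T = ringKrullDim (MvPolynomial σ k ⧸ P) := by
  rw [ringKrullDim_quotient, topologicalKrullDim]
  rw [← Order.krullDim_orderDual (α := PrimeSpectrum.zeroLocus (R := MvPolynomial σ k) P)]
  have hle : ∀ S : Set T, P ≤ vanishingIdeal k (f '' S) := by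
    intro S
    rw [← le_zeroLocus_iff_le_vanishingIdeal, ← hr]
    exact Set.image_subset_range _ _
  have hSS : ∀ S : TopologicalSpace.IrreducibleCloseds T,
      f ⁻¹' (zeroLocus k (vanishingIdeal k (f '' S))) = S := by
    intro S
    apply Set.Subset.antisymm
    · have h := S.isClosed
      subst hf
      rw [@isClosed_induced_iff _ _ (zariskiTopology k σ)] at h
      obtain ⟨t, ht, h⟩ := h
      obtain ⟨I, rfl⟩ := (aux_closed_iff t).1 ht
      rw [← h]
      refine Set.preimage_mono (zeroLocus_anti_mono ?_)
      rw [← le_zeroLocus_iff_le_vanishingIdeal]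
      exact Set.image_preimage_subset _ _
    · rw [← Set.image_subset_iff]
      exact zeroLocus_vanishingIdeal_le _
  apply le_antisymm
  · refine Order.krullDim_le_of_strictMono (fun S => OrderDual.toDual
      ⟨⟨vanishingIdeal k (f '' S), aux_prime f hf _ S.isIrreducible⟩, hle S⟩) ?_
    intro S S' h
    refine lt_of_le_of_ne ?_ ?_
    · change vanishingIdeal k (f '' S') ≤ vanishingIdeal k (f '' S)
      exact vanishingIdeal_anti_mono (Set.image_mono h.le)
    · intro heq
      have heq' : vanishingIdeal k (f '' S) = vanishingIdeal k (f '' S') :=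
        congrArg (fun z => (OrderDual.ofDual z).1.asIdeal) heq
      apply h.ne
      apply TopologicalSpace.IrreducibleCloseds.ext
      rw [← hSS S, heq', hSS S']
  · have hr' : ∀ Q : (PrimeSpectrum.zeroLocus (R := MvPolynomial σ k) P)ᵒᵈ,
        zeroLocus k (OrderDual.ofDual Q).1.asIdeal ⊆ Set.range f := fun Q => by
      rw [hr]; exact zeroLocus_anti_mono (OrderDual.ofDual Q).2
    refine Order.krullDim_le_of_strictMono (fun Q =>
      ⟨f ⁻¹' zeroLocus k (OrderDual.ofDual Q).1.asIdeal,
        (aux_irred f hf _ (hr' Q)).1,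
        (aux_irred f hf _ (hr' Q)).2.2⟩) ?_
    intro Q Q' h
    refine lt_of_le_of_ne ?_ ?_
    · have hh : (OrderDual.ofDual Q').1.asIdeal ≤ (OrderDual.ofDual Q).1.asIdeal := h.le
      exact Set.preimage_mono (f := f) (zeroLocus_anti_mono hh)
    · intro heq
      have heq' : f ⁻¹' zeroLocus k (OrderDual.ofDual Q).1.asIdeal =
        f ⁻¹' zeroLocus k (OrderDual.ofDual Q').1.asIdeal :=
        congrArg (fun z => z.carrier) heq
      apply h.ne
      apply OrderDual.ofDual.injective
      apply Subtype.ext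
      apply PrimeSpectrum.ext
      have h1 := (aux_irred f hf _ (hr' Q)).2.1
      have h2 := (aux_irred f hf _ (hr' Q')).2.1
      rw [heq', h2] at h1
      have := congrArg (vanishingIdeal k) h1
      simpa using this.symm

open MvPolynomial in
theorem aux_equidim {k : Type*} [Field k] [IsAlgClosed k] {σ : Type*} [Finite σ]
    (V : Set (σ → k)) {ι : Type*} [Finite ι] (P : ι → Ideal (MvPolynomial σ k))
    (hP : ∀ i, (P i).IsPrime) (hV : V = ⋃ i, zeroLocus k (P i)) (d : ℕ)
    (hd : ∀ i, ringKrullDim (MvPolynomial σ k ⧸ P i) = (d : WithBot ℕ∞)) :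
    IsEquidimOfDim k σ V d := by
  intro C hC
  let tV : TopologicalSpace V := TopologicalSpace.induced Subtype.val (zariskiTopology k σ)
  change Maximal IsIrreducible C at hC
  have hF : ∀ i, IsIrreducible ((Subtype.val : V → σ → k) ⁻¹' zeroLocus k (P i)) ∧
      (Subtype.val : V → σ → k) '' (Subtype.val ⁻¹' zeroLocus k (P i)) = zeroLocus k (P i) ∧
      IsClosed ((Subtype.val : V → σ → k) ⁻¹' zeroLocus k (P i)) := by
    intro i
    have := hP i
    refine aux_irred (Subtype.val : V → σ → k) rfl (P i) ?_
    rw [Subtype.range_coe, hV]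
    exact Set.subset_iUnion (fun i => zeroLocus k (P i)) i
  obtain ⟨z, hz, hCz⟩ := isIrreducible_iff_sUnion_isClosed.1 hC.prop
    (Set.finite_range fun i => (Subtype.val : V → σ → k) ⁻¹' zeroLocus k (P i)).toFinset
    (by
      intro z hz
      rw [Set.Finite.mem_toFinset] at hz
      obtain ⟨i, rfl⟩ := hz
      exact (hF i).2.2)
    (by
      rintro ⟨x, hx⟩ -
      have hx' := hx
      rw [hV] at hx'
      obtain ⟨i, hi⟩ := Set.mem_iUnion.1 hx'
      refine ⟨_, ?_, (show (⟨x, hx⟩ : V) ∈ (Subtype.val : V → σ → k) ⁻¹' zeroLocus k (P i) from hi)⟩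
      simp)
  rw [Set.Finite.mem_toFinset] at hz
  obtain ⟨i, rfl⟩ := hz
  have hCe : C = (Subtype.val : V → σ → k) ⁻¹' zeroLocus k (P i) :=
    Set.Subset.antisymm hCz (hC.le_of_ge (hF i).1 hCz)
  rw [← hd i]
  unfold zKrullDimSub
  refine aux_topdim (tT := TopologicalSpace.induced Subtype.val
    (TopologicalSpace.induced Subtype.val (zariskiTopology k σ)))
    (fun x : C => (x : V).val) ?_ (P i) ?_
  · rw [induced_compose]; rfl
  · rw [← (hF i).2.1, ← hCe]
    ext y
    simp

def auxEv {k : Type*} [Field k] (e : k) : PowerSeries (Polynomial k) →+* PowerSeries k :=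
  PowerSeries.map (Polynomial.evalRingHom e)

def auxCst {k : Type*} [Field k] : PowerSeries k →+* PowerSeries (Polynomial k) :=
  PowerSeries.map Polynomial.C

theorem auxEv_cst {k : Type*} [Field k] (e : k) (f : PowerSeries k) : auxEv e (auxCst f) = f := by
  ext n; simp [auxEv, auxCst]

def auxT {k : Type*} [Field k] : PowerSeries (Polynomial k) := PowerSeries.C Polynomial.X

theorem auxEv_T {k : Type*} [Field k] (e : k) : auxEv e (auxT : PowerSeries (Polynomial k)) =
    PowerSeries.C e := by
  simp [auxEv, auxT]

def AuxCurve {k : Type*} [Field k] (H : PowerSeries k → PowerSeries k → PowerSeries k →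
    PowerSeries k → Prop) : Prop :=
  ∀ (a b c d : PowerSeries (Polynomial k)) (h : Polynomial k), h ≠ 0 →
    (∀ e : k, h.eval e ≠ 0 → H (auxEv e a) (auxEv e b) (auxEv e c) (auxEv e d)) →
    H (auxEv 0 a) (auxEv 0 b) (auxEv 0 c) (auxEv 0 d)

def AuxBase {k : Type*} [Field k] (m : ℕ) (H : PowerSeries k → PowerSeries k → PowerSeries k →
    PowerSeries k → Prop) : Prop :=
  ∀ a b c d : PowerSeries k, PowerSeries.constantCoeff c ≠ 0 →
    (PowerSeries.X : PowerSeries k) ^ m ∣ a * b + c * d → H a b c d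

theorem aux_move {k : Type*} [Field k] {m : ℕ} {H : PowerSeries k → PowerSeries k →
    PowerSeries k → PowerSeries k → Prop} (hc : AuxCurve H) (hb : AuxBase m H) :
    AuxBase m (fun a b c d => H c d a b) := by
  intro c d a b ha hm
  have := hc (auxCst a) (auxCst b - auxT * auxCst d) (auxCst c + auxT * auxCst a) (auxCst d)
    (Polynomial.C (PowerSeries.constantCoeff c) +
      Polynomial.C (PowerSeries.constantCoeff a) * Polynomial.X) ?_ ?_
  · simpa [auxEv_cst, auxEv_T] using this
  · intro h
    have := congrArg (fun q => Polynomial.coeff q 1) h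
    simp [Polynomial.coeff_C] at this
    exact ha this
  · intro e he
    apply hb
    · simp only [map_add, map_mul, auxEv_cst, auxEv_T, PowerSeries.constantCoeff_C]
      have he' : PowerSeries.constantCoeff c + PowerSeries.constantCoeff a * e ≠ 0 := by
        simpa using he
      rwa [mul_comm e]
    · simp only [map_add, map_sub, map_mul, auxEv_cst, auxEv_T]
      convert hm using 1
      ring

theorem aux_pivot {k : Type*} [Field k] {m : ℕ} {H : PowerSeries k → PowerSeries k →
    PowerSeries k → PowerSeries k → Prop} (hc : AuxCurve H) (hb : AuxBase m H)
    (a b c d : PowerSeries k) (hca : c ∣ a) (hcb : c ∣ b)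
    (hm : (PowerSeries.X : PowerSeries k) ^ m ∣ a * b + c * d) : H a b c d := by
  obtain ⟨g, rfl⟩ := hca
  obtain ⟨f, rfl⟩ := hcb
  have := hc ((auxCst c + auxT ^ 2) * auxCst g + auxT * auxCst (d + c * g * f))
    ((auxCst c + auxT ^ 2) * auxCst f - auxT)
    (auxCst c + auxT ^ 2)
    (auxCst (d + c * g * f) - (auxCst c + auxT ^ 2) * auxCst g * auxCst f + auxT * auxCst g
      - auxT * auxCst f * auxCst (d + c * g * f))
    (Polynomial.C (PowerSeries.constantCoeff c) + Polynomial.X ^ 2) ?_ ?_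
  · simpa [auxEv_cst, auxEv_T] using this
  · intro h
    have := congrArg (fun q => Polynomial.coeff q 2) h
    simp [Polynomial.coeff_C] at this
  · intro e he
    apply hb
    · simp only [map_add, map_pow, auxEv_cst, auxEv_T, PowerSeries.constantCoeff_C]
      simpa using he
    · simp only [map_add, map_sub, map_mul, map_pow, auxEv_cst, auxEv_T]
      convert hm using 1
      ring

theorem aux_dense {k : Type*} [Field k] {m : ℕ} {H : PowerSeries k → PowerSeries k →
    PowerSeries k → PowerSeries k → Prop} (hc : AuxCurve H) (hb : AuxBase m H)
    (a b c d : PowerSeries k)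
    (hm : (PowerSeries.X : PowerSeries k) ^ m ∣ a * b + c * d) : H a b c d := by
  have hcp : ∀ H : PowerSeries k → PowerSeries k →
    PowerSeries k → PowerSeries k → Prop, AuxCurve H → AuxCurve (fun a b c d => H c d a b) :=
    fun H hc a b c d h h0 hh => hc c d a b h h0 hh
  have hc1 : ∀ H : PowerSeries k → PowerSeries k →
    PowerSeries k → PowerSeries k → Prop, AuxCurve H → AuxCurve (fun a b c d => H b a c d) :=
    fun H hc a b c d h h0 hh => hc b a c d h h0 hh
  have hb1 : ∀ H : PowerSeries k → PowerSeries k →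
    PowerSeries k → PowerSeries k → Prop, AuxBase m H → AuxBase m (fun a b c d => H b a c d) :=
    fun H hb a b c d h h0 => hb b a c d h (by rwa [mul_comm b a])
  have hP := aux_pivot hc hb a b c d
  have hPa := aux_pivot (hcp _ hc) (aux_move hc hb) c d a b
  have hPb := aux_pivot (hcp _ (hc1 _ hc)) (aux_move (hc1 _ hc) (hb1 _ hb)) c d b a
  have hPd := aux_pivot (hcp _ (hc1 _ (hcp _ hc)))
    (aux_move (hc1 _ (hcp _ hc)) (hb1 _ (aux_move hc hb))) a b d c
  have e1 : c * d + a * b = a * b + c * d := by ring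
  have e2 : c * d + b * a = a * b + c * d := by ring
  have e3 : a * b + d * c = a * b + c * d := by ring
  rw [e1] at hPa
  rw [e2] at hPb
  rw [e3] at hPd
  have tot : ∀ x y : PowerSeries k, x ∣ y ∨ y ∣ x := ValuationRing.dvd_total
  rcases tot a b with h1 | h1 <;> rcases tot c d with h2 | h2
  · rcases tot a c with h3 | h3
    · exact hPa h3 (h3.trans h2) hm
    · exact hP h3 (h3.trans h1) hm
  · rcases tot a d with h3 | h3
    · exact hPa (h3.trans h2) h3 hm
    · exact hPd h3 (h3.trans h1) hm
  · rcases tot b c with h3 | h3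
    · exact hPb h3 (h3.trans h2) hm
    · exact hP (h3.trans h1) h3 hm
  · rcases tot b d with h3 | h3
    · exact hPb (h3.trans h2) h3 hm
    · exact hPd (h3.trans h1) h3 hm

def auxC31 {R : Type*} [CommRing R] (p : ℕ) (y c : PowerSeries R) (w : ℕ → R) (n : ℕ) : R :=
  PowerSeries.coeff (p - n) y +
    ∑ r ∈ Finset.Icc 1 (n - 1), w r * PowerSeries.coeff (p - (n - r)) c

def auxC33 {R : Type*} [CommRing R] (p : ℕ) (a y b c : PowerSeries R) (w : ℕ → R) (i : ℕ) : R :=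
  ∑ s ∈ Finset.Icc 1 (i - 1),
      (PowerSeries.coeff (p - s) a * auxC31 p y c w (i - s) +
        PowerSeries.coeff (p - s) b * PowerSeries.coeff (p - (i - s)) c)
    - ∑ r ∈ Finset.Icc 1 (i - 2), ∑ s ∈ Finset.Icc 1 (i - r - 1),
        PowerSeries.coeff (p - r) a * w s * PowerSeries.coeff (p - (i - r - s)) c

def auxPt {R : Type*} [CommRing R] (p : ℕ) (a y b c : PowerSeries R) (w : ℕ → R) :
    Fin 3 × Fin 3 × Fin p → R := fun z =>
  if z.1 = 0 ∧ z.2.1 = 2 then PowerSeries.coeff (p - (z.2.2 + 1)) a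
  else if z.1 = 1 ∧ z.2.1 = 2 then PowerSeries.coeff (p - (z.2.2 + 1)) b
  else if z.1 = 2 ∧ z.2.1 = 1 then PowerSeries.coeff (p - (z.2.2 + 1)) c
  else if z.1 = 1 ∧ z.2.1 = 0 then w (z.2.2 + 1)
  else if z.1 = 2 ∧ z.2.1 = 0 then auxC31 p y c w (z.2.2 + 1)
  else if z.1 = 2 ∧ z.2.1 = 2 then auxC33 p a y b c w (z.2.2 + 1)
  else 0

theorem auxPt_map {R S : Type*} [CommRing R] [CommRing S] (f : R →+* S) (p : ℕ)
    (a y b c : PowerSeries R) (w : ℕ → R) (z : Fin 3 × Fin 3 × Fin p) :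
    f (auxPt p a y b c w z) = auxPt p (PowerSeries.map f a) (PowerSeries.map f y)
      (PowerSeries.map f b) (PowerSeries.map f c) (fun n => f (w n)) z := by
  have h31 : ∀ n, f (auxC31 p y c w n) = auxC31 p (PowerSeries.map f y) (PowerSeries.map f c)
      (fun n => f (w n)) n := fun n => by
    simp only [auxC31, map_add, map_sum, map_mul, PowerSeries.coeff_map]
  have h33 : ∀ n, f (auxC33 p a y b c w n) = auxC33 p (PowerSeries.map f a) (PowerSeries.map f y)
      (PowerSeries.map f b) (PowerSeries.map f c) (fun n => f (w n)) n := fun n => by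
    simp only [auxC33, map_sub, map_add, map_sum, map_mul, PowerSeries.coeff_map, h31]
  simp only [auxPt, apply_ite f, map_zero, h31, h33, PowerSeries.coeff_map]

section
variable {R : Type*} [CommRing R] (p : ℕ) (a y b c : PowerSeries R) (w : ℕ → R)

theorem auxPt_zero (i j n : ℕ) (h : (i = 1 ∧ j = 1) ∨ (i = 1 ∧ j = 2) ∨ (i = 2 ∧ j = 2)) :
    xvn R 3 p (auxPt p a y b c w) i j n = 0 := by
  rcases h with ⟨rfl, rfl⟩ | ⟨rfl, rfl⟩ | ⟨rfl, rfl⟩ <;> simp [xvn, auxPt]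

theorem auxPt_13 (n : ℕ) (h : 1 ≤ n) (h' : n ≤ p) :
    xvn R 3 p (auxPt p a y b c w) 1 3 n = PowerSeries.coeff (p - n) a := by
  simp [xvn, auxPt, h, h']
theorem auxPt_23 (n : ℕ) (h : 1 ≤ n) (h' : n ≤ p) :
    xvn R 3 p (auxPt p a y b c w) 2 3 n = PowerSeries.coeff (p - n) b := by
  simp [xvn, auxPt, h, h']
theorem auxPt_32 (n : ℕ) (h : 1 ≤ n) (h' : n ≤ p) :
    xvn R 3 p (auxPt p a y b c w) 3 2 n = PowerSeries.coeff (p - n) c := by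
  simp [xvn, auxPt, h, h']
theorem auxPt_21 (n : ℕ) (h : 1 ≤ n) (h' : n ≤ p) :
    xvn R 3 p (auxPt p a y b c w) 2 1 n = w n := by
  simp [xvn, auxPt, h, h']
theorem auxPt_31 (n : ℕ) (h : 1 ≤ n) (h' : n ≤ p) :
    xvn R 3 p (auxPt p a y b c w) 3 1 n = auxC31 p y c w n := by
  simp [xvn, auxPt, h, h']
theorem auxPt_33 (n : ℕ) (h : 1 ≤ n) (h' : n ≤ p) :
    xvn R 3 p (auxPt p a y b c w) 3 3 n = auxC33 p a y b c w n := by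
  simp [xvn, auxPt, h, h']
end

def auxZ {R : Type*} [CommRing R] (p : ℕ) (x : Fin 3 × Fin 3 × Fin p → R) (n : ℕ) : R :=
  ∑ r ∈ Finset.Icc 1 (n - 1), xvn R 3 p x 2 1 r * xvn R 3 p x 3 2 (n - r)

theorem aux_xvn_out {R : Type*} [CommRing R] (p : ℕ) (x : Fin 3 × Fin 3 × Fin p → R)
    (i j n : ℕ) (h : n < 1 ∨ p < n) : xvn R 3 p x i j n = 0 := by
  unfold xvn
  rw [dif_neg]
  omega

theorem auxPt_Z {R : Type*} [CommRing R] (p : ℕ) (a y b c : PowerSeries R) (w : ℕ → R)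
    (n : ℕ) (h : 1 ≤ n) (h' : n ≤ p) :
    xvn R 3 p (auxPt p a y b c w) 3 1 n - auxZ p (auxPt p a y b c w) n =
      PowerSeries.coeff (p - n) y := by
  rw [auxPt_31 p a y b c w n h h', auxC31, auxZ, sub_eq_iff_eq_add]
  congr 1
  refine Finset.sum_congr rfl fun r hr => ?_
  rw [Finset.mem_Icc] at hr
  rw [auxPt_21 _ _ _ _ _ _ _ (by omega) (by omega), auxPt_32 _ _ _ _ _ _ _ (by omega) (by omega)]

theorem aux_P3_low {R : Type*} [CommRing R] (p : ℕ) (x : Fin 3 × Fin 3 × Fin p → R)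
    (h : WZero R 3 p x) (i : ℕ) (hi : i ≤ p) : P3v R 3 p x i = xvn R 3 p x 3 3 i -
      (∑ s ∈ Finset.Icc 1 (i - 1),
          (xvn R 3 p x 1 3 s * xvn R 3 p x 3 1 (i - s) +
           xvn R 3 p x 2 3 s * xvn R 3 p x 3 2 (i - s))
      - ∑ r ∈ Finset.Icc 1 (i - 2), ∑ s ∈ Finset.Icc 1 (i - r - 1),
          xvn R 3 p x 1 3 r * xvn R 3 p x 2 1 s * xvn R 3 p x 3 2 (i - r - s)) := by
  have h12 : ∀ t, xvn R 3 p x 1 2 t = 0 := fun t => by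
    by_cases ht : 1 ≤ t ∧ t ≤ p
    · exact (h t ht.1 ht.2).2.1
    · exact aux_xvn_out p x _ _ _ (by omega)
  have h22 : ∀ t, xvn R 3 p x 2 2 t = 0 := fun t => by
    by_cases ht : 1 ≤ t ∧ t ≤ p
    · exact (h t ht.1 ht.2).2.2
    · exact aux_xvn_out p x _ _ _ (by omega)
  unfold P3v
  rw [if_pos hi]
  simp only [h12, h22, mul_zero, zero_mul, Finset.sum_const_zero, sub_zero, zero_add]
  ring

theorem aux_P3_high {R : Type*} [CommRing R] (p s : ℕ) (x : Fin 3 × Fin 3 × Fin p → R)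
    (hs : 1 ≤ s) (hsp : s ≤ p + 1)
    (h : WZero R 3 p x) (h21 : ∀ t : ℕ, s ≤ t → t ≤ p → xvn R 3 p x 2 1 t = 0)
    (h32 : ∀ t : ℕ, p + 2 - s ≤ t → t ≤ p → xvn R 3 p x 3 2 t = 0)
    (i : ℕ) (hi : p < i) (hi2 : i ≤ 2 * p) : P3v R 3 p x i =
      - ∑ r ∈ Finset.Icc (i - p) p, (xvn R 3 p x 1 3 r * (xvn R 3 p x 3 1 (i - r) - auxZ p x (i - r))
        + xvn R 3 p x 2 3 r * xvn R 3 p x 3 2 (i - r)) := by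
  have h12 : ∀ t, xvn R 3 p x 1 2 t = 0 := fun t => by
    by_cases ht : 1 ≤ t ∧ t ≤ p
    · exact (h t ht.1 ht.2).2.1
    · exact aux_xvn_out p x _ _ _ (by omega)
  have h22 : ∀ t, xvn R 3 p x 2 2 t = 0 := fun t => by
    by_cases ht : 1 ≤ t ∧ t ≤ p
    · exact (h t ht.1 ht.2).2.2
    · exact aux_xvn_out p x _ _ _ (by omega)
  have hz : ∀ t m, p < t + m → xvn R 3 p x 2 1 t * xvn R 3 p x 3 2 m = 0 := by
    intro t m htm
    by_cases h1 : s ≤ t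
    · by_cases h2 : t ≤ p
      · rw [h21 t h1 h2, zero_mul]
      · rw [aux_xvn_out p x 2 1 t (by omega), zero_mul]
    · by_cases h2 : m ≤ p
      · rw [h32 m (by omega) h2, mul_zero]
      · rw [aux_xvn_out p x 3 2 m (by omega), mul_zero]
  have hrhs : - ∑ r ∈ Finset.Icc (i - p) p,
      (xvn R 3 p x 1 3 r * (xvn R 3 p x 3 1 (i - r) - auxZ p x (i - r))
        + xvn R 3 p x 2 3 r * xvn R 3 p x 3 2 (i - r)) =
      - ∑ r ∈ Finset.Icc (i - p) p, (xvn R 3 p x 1 3 r * xvn R 3 p x 3 1 (i - r)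
        + xvn R 3 p x 2 3 r * xvn R 3 p x 3 2 (i - r)) +
      ∑ r ∈ Finset.Icc (i - p) p, ∑ t ∈ Finset.Icc 1 (i - r - 1),
        xvn R 3 p x 1 3 r * xvn R 3 p x 2 1 t * xvn R 3 p x 3 2 (i - r - t) := by
    rw [← Finset.sum_neg_distrib, ← Finset.sum_neg_distrib, ← Finset.sum_add_distrib]
    refine Finset.sum_congr rfl fun r _ => ?_
    simp only [auxZ, mul_assoc]
    rw [← Finset.mul_sum]
    ring
  rw [hrhs]
  unfold P3v
  rw [if_neg (by omega)]
  by_cases h1 : i = p + 1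
  · rw [if_pos h1]
    subst h1
    simp only [h12, h22, mul_zero, zero_mul, Finset.sum_const_zero, sub_zero, zero_add]
    have e1 : p + 1 - p = 1 := by omega
    rw [e1]
    congr 1
    have hp : p = (p - 1) + 1 := by omega
    rw [show Finset.Icc 1 p = Finset.Icc 1 ((p - 1) + 1) by rw [← hp],
      Finset.sum_Icc_succ_top (by omega), ← hp, e1]
    simp only [Nat.sub_self, Finset.Icc_eq_empty_of_lt Nat.zero_lt_one, Finset.sum_empty, add_zero]
    refine Finset.sum_congr rfl fun r hr => ?_
    rw [show p + 1 - r - 1 = p - r by omega]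
  · rw [if_neg h1, if_pos hi2]
    simp only [Tv, h12, h22, mul_zero, zero_mul, neg_zero, zero_add]
    rw [add_assoc]
    congr 1
    refine (add_eq_right.2 ?_)
    refine Finset.sum_eq_zero fun r hr => Finset.sum_eq_zero fun t ht => ?_
    rw [Finset.mem_Icc] at hr ht
    by_cases h3 : r + t < i
    · rw [mul_assoc, hz t (i - r - t) (by omega), mul_zero]
    · rw [aux_xvn_out p x 3 2 _ (by omega), mul_zero]

theorem aux_coeff_mul {R : Type*} [CommRing R] (p i : ℕ) (f g : PowerSeries R) (hi : p < i)
    (hi2 : i ≤ 2 * p) :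
    PowerSeries.coeff (2 * p - i) (f * g) =
      ∑ r ∈ Finset.Icc (i - p) p, PowerSeries.coeff (p - r) f * PowerSeries.coeff (p - (i - r)) g := by
  rw [PowerSeries.coeff_mul, Finset.Nat.sum_antidiagonal_eq_sum_range_succ_mk]
  refine Finset.sum_nbij' (fun z => p - z) (fun r => p - r) ?_ ?_ ?_ ?_ ?_
  · intro u h
    rw [Finset.mem_range] at h
    rw [Finset.mem_Icc]
    omega
  · intro r h
    rw [Finset.mem_Icc] at h
    rw [Finset.mem_range]
    omega
  · intro u h
    rw [Finset.mem_range] at h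
    omega
  · intro r h
    rw [Finset.mem_Icc] at h
    omega
  · intro u h
    rw [Finset.mem_range] at h
    dsimp only
    rw [show p - (p - u) = u by omega, show p - (i - (p - u)) = 2 * p - i - u by omega]

theorem aux_mem_W {R : Type*} [CommRing R] (p s : ℕ) (hs : 1 ≤ s) (hsp : s ≤ p + 1)
    (a y b c : PowerSeries R) (w : ℕ → R) (hw : ∀ t, s ≤ t → w t = 0)
    (hc : (PowerSeries.X : PowerSeries R) ^ (s - 1) ∣ c)
    (hm : (PowerSeries.X : PowerSeries R) ^ p ∣ a * y + b * c) :
    auxPt p a y b c w ∈ W2s R 3 p s := by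
  have hW : WZero R 3 p (auxPt p a y b c w) := fun t _ _ =>
    ⟨auxPt_zero p a y b c w _ _ _ (by simp), auxPt_zero p a y b c w _ _ _ (by simp),
      auxPt_zero p a y b c w _ _ _ (by simp)⟩
  have h21 : ∀ t : ℕ, s ≤ t → t ≤ p → xvn R 3 p (auxPt p a y b c w) 2 1 t = 0 := by
    intro t h1 h2
    rw [auxPt_21 _ _ _ _ _ _ _ (by omega) h2, hw t h1]
  have h32 : ∀ t : ℕ, p + 2 - s ≤ t → t ≤ p → xvn R 3 p (auxPt p a y b c w) 3 2 t = 0 := by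
    intro t h1 h2
    rw [auxPt_32 _ _ _ _ _ _ _ (by omega) h2]
    exact PowerSeries.X_pow_dvd_iff.1 hc _ (by omega)
  refine ⟨hW, ?_, h21, h32, fun m j h4 h3 => by omega⟩
  intro j hj1 hj2
  by_cases hj : j ≤ p
  · rw [aux_P3_low p _ hW j hj, auxPt_33 _ _ _ _ _ _ _ hj1 hj, auxC33, sub_eq_zero]
    congr 1
    · refine Finset.sum_congr rfl fun r hr => ?_
      rw [Finset.mem_Icc] at hr
      rw [auxPt_13 _ _ _ _ _ _ _ (by omega) (by omega), auxPt_31 _ _ _ _ _ _ _ (by omega) (by omega),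
        auxPt_23 _ _ _ _ _ _ _ (by omega) (by omega), auxPt_32 _ _ _ _ _ _ _ (by omega) (by omega)]
    · refine Finset.sum_congr rfl fun r hr => Finset.sum_congr rfl fun t ht => ?_
      rw [Finset.mem_Icc] at hr ht
      rw [auxPt_13 _ _ _ _ _ _ _ (by omega) (by omega), auxPt_21 _ _ _ _ _ _ _ (by omega) (by omega),
        auxPt_32 _ _ _ _ _ _ _ (by omega) (by omega)]
  · rw [aux_P3_high p s _ hs hsp hW h21 h32 j (by omega) hj2, neg_eq_zero]
    have := PowerSeries.X_pow_dvd_iff.1 hm (2 * p - j) (by omega)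
    rw [map_add, aux_coeff_mul p j _ _ (by omega) hj2, aux_coeff_mul p j _ _ (by omega) hj2,
      ← Finset.sum_add_distrib] at this
    rw [← this]
    refine Finset.sum_congr rfl fun r hr => ?_
    rw [Finset.mem_Icc] at hr
    rw [auxPt_Z _ _ _ _ _ _ _ (by omega) (by omega), auxPt_13 _ _ _ _ _ _ _ (by omega) (by omega),
      auxPt_23 _ _ _ _ _ _ _ (by omega) (by omega), auxPt_32 _ _ _ _ _ _ _ (by omega) (by omega)]

theorem aux_of_mem_W {R : Type*} [CommRing R] (p s : ℕ) (hs : 1 ≤ s) (hsp : s ≤ p + 1)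
    (x : Fin 3 × Fin 3 × Fin p → R) (hx : x ∈ W2s R 3 p s) :
    ∃ (a y b c : PowerSeries R) (w : ℕ → R), x = auxPt p a y b c w ∧ (∀ t, s ≤ t → w t = 0) ∧
    (PowerSeries.X : PowerSeries R) ^ (s - 1) ∣ c ∧
    (PowerSeries.X : PowerSeries R) ^ p ∣ a * y + b * c := by
  obtain ⟨hW, hP, h21, h32, -⟩ := hx
  set a : PowerSeries R := PowerSeries.mk fun j => xvn R 3 p x 1 3 (p - j) with ha
  set b : PowerSeries R := PowerSeries.mk fun j => xvn R 3 p x 2 3 (p - j) with hb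
  set c : PowerSeries R := PowerSeries.mk fun j => xvn R 3 p x 3 2 (p - j) with hc
  set y : PowerSeries R := PowerSeries.mk fun j => xvn R 3 p x 3 1 (p - j) - auxZ p x (p - j) with hy
  set w : ℕ → R := xvn R 3 p x 2 1 with hw
  have ca : ∀ n, n ≤ p → PowerSeries.coeff (p - n) a = xvn R 3 p x 1 3 n := fun n hn => by
    rw [ha, PowerSeries.coeff_mk, Nat.sub_sub_self hn]
  have cb : ∀ n, n ≤ p → PowerSeries.coeff (p - n) b = xvn R 3 p x 2 3 n := fun n hn => by
    rw [hb, PowerSeries.coeff_mk, Nat.sub_sub_self hn]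
  have cc : ∀ n, n ≤ p → PowerSeries.coeff (p - n) c = xvn R 3 p x 3 2 n := fun n hn => by
    rw [hc, PowerSeries.coeff_mk, Nat.sub_sub_self hn]
  have cy : ∀ n, n ≤ p → PowerSeries.coeff (p - n) y = xvn R 3 p x 3 1 n - auxZ p x n :=
    fun n hn => by rw [hy, PowerSeries.coeff_mk, Nat.sub_sub_self hn]
  have c31 : ∀ n, n ≤ p → auxC31 p y c w n = xvn R 3 p x 3 1 n := fun n hn => by
    rw [auxC31, cy n hn, auxZ, sub_add, sub_eq_self, sub_eq_zero]
    refine Finset.sum_congr rfl fun r hr => ?_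
    rw [cc _ (by omega)]
  have c33 : ∀ n, 1 ≤ n → n ≤ p → auxC33 p a y b c w n = xvn R 3 p x 3 3 n := fun n hn1 hn => by
    have h := hP n hn1 (by omega)
    rw [aux_P3_low p x hW n hn, sub_eq_zero] at h
    rw [h, auxC33]
    congr 1
    · refine Finset.sum_congr rfl fun r hr => ?_
      rw [Finset.mem_Icc] at hr
      rw [ca _ (by omega), cb _ (by omega), cc _ (by omega), c31 _ (by omega)]
    · refine Finset.sum_congr rfl fun r hr => Finset.sum_congr rfl fun t ht => ?_
      rw [Finset.mem_Icc] at hr ht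
      rw [ca _ (by omega), cc _ (by omega)]
  refine ⟨a, y, b, c, w, ?_, ?_, ?_, ?_⟩
  · have hx : ∀ (i j : Fin 3) (t : Fin p), x (i, j, t) = xvn R 3 p x (i + 1) (j + 1) (t + 1) := by
      intro i j t
      have := i.2
      have := j.2
      have := t.2
      rw [xvn, dif_pos (by omega)]
      simp
    funext ⟨i, j, t⟩
    have ht : (t : ℕ) + 1 ≤ p := t.2
    have hWt := hW (t + 1) (by omega) ht
    rw [hx]
    fin_cases i <;> fin_cases j <;> simp [auxPt, ca, cb, cc, c31, c33, ht, hWt]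
    rfl
  · intro t ht
    by_cases h : t ≤ p
    · exact h21 t ht h
    · exact aux_xvn_out p x 2 1 t (by omega)
  · rw [PowerSeries.X_pow_dvd_iff]
    intro m hm
    rw [hc, PowerSeries.coeff_mk]
    exact h32 _ (by omega) (by omega)
  · rw [PowerSeries.X_pow_dvd_iff]
    intro m hm
    have h := hP (2 * p - m) (by omega) (by omega)
    rw [aux_P3_high p s x hs hsp hW h21 h32 _ (by omega) (by omega), neg_eq_zero] at h
    obtain ⟨j, rfl, hj, hj2⟩ : ∃ j, m = 2 * p - j ∧ p < j ∧ j ≤ 2 * p :=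
      ⟨2 * p - m, by omega, by omega, by omega⟩
    rw [map_add, aux_coeff_mul p j _ _ hj hj2, aux_coeff_mul p j _ _ hj hj2,
      ← Finset.sum_add_distrib, ← h]
    rw [show 2 * p - (2 * p - j) = j by omega]
    refine Finset.sum_congr rfl fun r hr => ?_
    rw [Finset.mem_Icc] at hr
    rw [ca _ (by omega), cb _ (by omega), cc _ (by omega), cy _ (by omega)]

theorem aux_map_xvn {R S : Type*} [CommRing R] [CommRing S] (f : R →+* S) (p : ℕ)
    (x : Fin 3 × Fin 3 × Fin p → R) (a b t : ℕ) :
    f (xvn R 3 p x a b t) = xvn S 3 p (fun z => f (x z)) a b t := by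
  unfold xvn
  split_ifs <;> simp

theorem aux_map_P3v {R S : Type*} [CommRing R] [CommRing S] (f : R →+* S) (p : ℕ)
    (x : Fin 3 × Fin 3 × Fin p → R) (t : ℕ) :
    f (P3v R 3 p x t) = P3v S 3 p (fun z => f (x z)) t := by
  simp only [P3v, Tv, apply_ite f, map_add, map_sub, map_neg, map_sum, map_mul, aux_map_xvn]

theorem aux_W_transfer {Q R S : Type*} [CommRing Q] [CommRing R] [CommRing S] (f : Q →+* R)
    (g : Q →+* S) (hfg : ∀ z, f z = 0 → g z = 0) (p s : ℕ) (x : Fin 3 × Fin 3 × Fin p → Q)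
    (h : (fun z => f (x z)) ∈ W2s R 3 p s) : (fun z => g (x z)) ∈ W2s S 3 p s := by
  have hx : ∀ a b t, xvn R 3 p (fun z => f (x z)) a b t = 0 →
      xvn S 3 p (fun z => g (x z)) a b t = 0 := by
    intro a b t ht
    rw [← aux_map_xvn] at ht ⊢
    exact hfg _ ht
  have hP : ∀ t, P3v R 3 p (fun z => f (x z)) t = 0 → P3v S 3 p (fun z => g (x z)) t = 0 := by
    intro t ht
    rw [← aux_map_P3v] at ht ⊢
    exact hfg _ ht
  obtain ⟨h1, h2, h3, h4, -⟩ := h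
  refine ⟨fun t ht ht' => ⟨hx _ _ _ (h1 t ht ht').1, hx _ _ _ (h1 t ht ht').2.1,
    hx _ _ _ (h1 t ht ht').2.2⟩, fun j hj hj' => hP _ (h2 j hj hj'),
    fun t ht ht' => hx _ _ _ (h3 t ht ht'), fun t ht ht' => hx _ _ _ (h4 t ht ht'),
    fun m j h4 h3 => by omega⟩

theorem auxPt_congr {R : Type*} [CommRing R] (p : ℕ) (a y b c a' y' b' c' : PowerSeries R)
    (w w' : ℕ → R) (ha : (PowerSeries.X : PowerSeries R) ^ p ∣ a - a')
    (hy : (PowerSeries.X : PowerSeries R) ^ p ∣ y - y')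
    (hb : (PowerSeries.X : PowerSeries R) ^ p ∣ b - b')
    (hc : (PowerSeries.X : PowerSeries R) ^ p ∣ c - c')
    (hw : ∀ t, 1 ≤ t → t ≤ p → w t = w' t) : auxPt p a y b c w = auxPt p a' y' b' c' w' := by
  have key : ∀ f f' : PowerSeries R, (PowerSeries.X : PowerSeries R) ^ p ∣ f - f' →
      ∀ n, 1 ≤ n → n ≤ p → PowerSeries.coeff (p - n) f = PowerSeries.coeff (p - n) f' := by
    intro f f' h n h1 h2
    have := PowerSeries.X_pow_dvd_iff.1 h (p - n) (by omega)
    rwa [map_sub, sub_eq_zero] at this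
  have h31 : ∀ n, 1 ≤ n → n ≤ p → auxC31 p y c w n = auxC31 p y' c' w' n := by
    intro n h1 h2
    unfold auxC31
    rw [key y y' hy n h1 h2]
    congr 1
    refine Finset.sum_congr rfl fun r hr => ?_
    rw [Finset.mem_Icc] at hr
    rw [hw r (by omega) (by omega), key c c' hc _ (by omega) (by omega)]
  have h33 : ∀ n, 1 ≤ n → n ≤ p → auxC33 p a y b c w n = auxC33 p a' y' b' c' w' n := by
    intro n h1 h2
    unfold auxC33
    congr 1
    · refine Finset.sum_congr rfl fun r hr => ?_
      rw [Finset.mem_Icc] at hr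
      rw [key a a' ha _ (by omega) (by omega), key b b' hb _ (by omega) (by omega),
        key c c' hc _ (by omega) (by omega), h31 _ (by omega) (by omega)]
    · refine Finset.sum_congr rfl fun r hr => Finset.sum_congr rfl fun t ht => ?_
      rw [Finset.mem_Icc] at hr ht
      rw [key a a' ha _ (by omega) (by omega), hw _ (by omega) (by omega),
        key c c' hc _ (by omega) (by omega)]
  funext z
  have h1 : 1 ≤ (z.2.2 : ℕ) + 1 := by omega
  have h2 : (z.2.2 : ℕ) + 1 ≤ p := z.2.2.2
  unfold auxPt
  rw [key a a' ha _ h1 h2, key b b' hb _ h1 h2, key c c' hc _ h1 h2, hw _ h1 h2, h31 _ h1 h2,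
    h33 _ h1 h2]

def auxSer {R : Type*} [CommRing R] (n : ℕ) (f : Fin n → R) : PowerSeries R :=
  PowerSeries.mk fun j => if h : j < n then f ⟨j, h⟩ else 0

theorem auxSer_coeff {R : Type*} [CommRing R] (n : ℕ) (f : Fin n → R) (j : Fin n) :
    PowerSeries.coeff (j : ℕ) (auxSer n f) = f j := by
  simp [auxSer]

theorem auxSer_dvd {R : Type*} [CommRing R] (n : ℕ) (f : PowerSeries R) :
    (PowerSeries.X : PowerSeries R) ^ n ∣ auxSer n (fun j => PowerSeries.coeff (j : ℕ) f) - f := by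
  rw [PowerSeries.X_pow_dvd_iff]
  intro m hm
  simp [auxSer, hm]

theorem auxSer_map {R S : Type*} [CommRing R] [CommRing S] (f : R →+* S) (n : ℕ) (u : Fin n → R) :
    PowerSeries.map f (auxSer n u) = auxSer n (fun j => f (u j)) := by
  ext j
  simp only [auxSer, PowerSeries.coeff_map, PowerSeries.coeff_mk]
  split_ifs <;> simp

def auxWf {R : Type*} [CommRing R] (e : ℕ) (f : Fin e → R) (n : ℕ) : R :=
  if h : 1 ≤ n ∧ n ≤ e then f ⟨n - 1, by omega⟩ else 0

theorem auxWf_map {R S : Type*} [CommRing R] [CommRing S] (f : R →+* S) (e : ℕ) (u : Fin e → R)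
    (n : ℕ) : f (auxWf e u n) = auxWf e (fun j => f (u j)) n := by
  unfold auxWf
  split_ifs <;> simp

abbrev auxTau (p e i : ℕ) : Type := Fin p ⊕ (Fin (p - i) ⊕ (Fin (p - e + i) ⊕ Fin e))

def auxB {R : Type*} [CommRing R] {p e i : ℕ} (t : auxTau p e i → R) : PowerSeries R :=
  auxSer p fun j => t (Sum.inl j)
def auxG {R : Type*} [CommRing R] {p e i : ℕ} (t : auxTau p e i → R) : PowerSeries R :=
  auxSer (p - i) fun j => t (Sum.inr (Sum.inl j))
def auxY {R : Type*} [CommRing R] {p e i : ℕ} (t : auxTau p e i → R) : PowerSeries R :=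
  auxSer (p - e + i) fun j => t (Sum.inr (Sum.inr (Sum.inl j)))
def auxW {R : Type*} [CommRing R] {p e i : ℕ} (t : auxTau p e i → R) : ℕ → R :=
  auxWf e fun j => t (Sum.inr (Sum.inr (Sum.inr j)))

def auxTOf {R : Type*} [CommRing R] (p e i : ℕ) (b g y : PowerSeries R) (w : ℕ → R) :
    auxTau p e i → R :=
  Sum.elim (fun j => PowerSeries.coeff (j : ℕ) b) (Sum.elim (fun j => PowerSeries.coeff (j : ℕ) g)
    (Sum.elim (fun j => PowerSeries.coeff (j : ℕ) y) (fun j => w (j + 1))))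

def auxQ {R : Type*} [CommRing R] (p e i : ℕ) (t : auxTau p e i → R) :
    Fin 3 × Fin 3 × Fin p → R :=
  auxPt p (PowerSeries.X ^ i * (auxB t * auxG t)) (PowerSeries.X ^ (e - i) * auxY t) (auxB t)
    (PowerSeries.X ^ e * (-(auxG t * auxY t))) (auxW t)

theorem auxQ_map {R S : Type*} [CommRing R] [CommRing S] (f : R →+* S) (p e i : ℕ)
    (t : auxTau p e i → R) (z : Fin 3 × Fin 3 × Fin p) :
    f (auxQ p e i t z) = auxQ p e i (fun v => f (t v)) z := by
  unfold auxQ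
  rw [auxPt_map]
  have : (fun n => f (auxW t n)) = auxW (fun v => f (t v)) := by
    funext n
    exact auxWf_map f e _ n
  rw [this]
  simp only [map_mul, map_pow, map_neg, PowerSeries.map_X, auxB, auxG, auxY, auxSer_map]

theorem auxQ_tof {R : Type*} [CommRing R] (p e i : ℕ) (hi : i ≤ e) (he : e ≤ p)
    (b g y : PowerSeries R) (w : ℕ → R) (hw : ∀ t, e + 1 ≤ t → w t = 0) :
    auxQ p e i (auxTOf p e i b g y w) =
      auxPt p (PowerSeries.X ^ i * (b * g)) (PowerSeries.X ^ (e - i) * y) b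
        (PowerSeries.X ^ e * (-(g * y))) w := by
  have hB : (PowerSeries.X : PowerSeries R) ^ p ∣ auxB (auxTOf p e i b g y w) - b :=
    auxSer_dvd p b
  have hG : (PowerSeries.X : PowerSeries R) ^ (p - i) ∣ auxG (auxTOf p e i b g y w) - g :=
    auxSer_dvd (p - i) g
  have hY : (PowerSeries.X : PowerSeries R) ^ (p - e + i) ∣ auxY (auxTOf p e i b g y w) - y :=
    auxSer_dvd (p - e + i) y
  unfold auxQ
  generalize auxB (auxTOf p e i b g y w) = B at *
  generalize auxG (auxTOf p e i b g y w) = G at *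
  generalize auxY (auxTOf p e i b g y w) = Y at *
  refine auxPt_congr p _ _ _ _ _ _ _ _ _ _ ?_ ?_ hB ?_ ?_
  · rw [← mul_sub, show p = i + (p - i) by omega, pow_add]
    refine mul_dvd_mul_left _ ?_
    have : B * G - b * g = (B - b) * G + b * (G - g) := by ring
    rw [this]
    exact dvd_add (((pow_dvd_pow _ (by omega)).trans hB).mul_right _) (hG.mul_left _)
  · rw [← mul_sub]
    refine dvd_trans ?_ (mul_dvd_mul_left _ hY)
    rw [← pow_add]
    exact pow_dvd_pow _ (by omega)
  · rw [← mul_sub]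
    have : -(G * Y) - -(g * y) = -((G - g) * Y + g * (Y - y)) := by ring
    rw [this]
    have h1 : (PowerSeries.X : PowerSeries R) ^ (p - e) ∣ -((G - g) * Y + g * (Y - y)) := by
      rw [dvd_neg]
      exact dvd_add (((pow_dvd_pow _ (by omega)).trans hG).mul_right _)
        (((pow_dvd_pow _ (by omega)).trans hY).mul_left _)
    refine dvd_trans ?_ (mul_dvd_mul_left _ h1)
    rw [← pow_add]
    exact pow_dvd_pow _ (by omega)
  · intro t h1 h2
    unfold auxW auxWf auxTOf
    split_ifs with h
    · simp only [Sum.elim_inr]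
      congr 1
      omega
    · exact (hw t (by omega)).symm

def auxR {R : Type*} [CommRing R] (p e i : ℕ) (x : Fin 3 × Fin 3 × Fin p → R) : auxTau p e i → R :=
  Sum.elim (fun j => xvn R 3 p x 2 3 (p - j)) (Sum.elim (fun j => xvn R 3 p x 1 3 (p - i - j))
    (Sum.elim (fun j => xvn R 3 p x 3 1 (p - (e - i) - j) - auxZ p x (p - (e - i) - j))
      (fun j => xvn R 3 p x 2 1 (j + 1))))

theorem auxR_map {R S : Type*} [CommRing R] [CommRing S] (f : R →+* S) (p e i : ℕ)
    (x : Fin 3 × Fin 3 × Fin p → R) (v : auxTau p e i) :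
    f (auxR p e i x v) = auxR p e i (fun z => f (x z)) v := by
  rcases v with v | v | v | v <;>
    simp only [auxR, Sum.elim_inl, Sum.elim_inr, map_sub, auxZ, map_sum, map_mul, aux_map_xvn]

theorem auxR_pt {R : Type*} [CommRing R] (p e i : ℕ) (hi : i ≤ e) (he : e ≤ p)
    (u : auxTau p e i → R) (c : PowerSeries R) :
    auxR p e i (auxPt p (PowerSeries.X ^ i * auxG u) (PowerSeries.X ^ (e - i) * auxY u) (auxB u)
      c (auxW u)) = u := by
  funext v
  rcases v with v | v | v | v
  · have := v.2
    simp only [auxR, Sum.elim_inl, Sum.elim_inr]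
    rw [auxPt_23 _ _ _ _ _ _ _ (by omega) (by omega), show p - (p - v) = (v : ℕ) by omega]
    exact auxSer_coeff _ _ _
  · have := v.2
    simp only [auxR, Sum.elim_inl, Sum.elim_inr]
    rw [auxPt_13 _ _ _ _ _ _ _ (by omega) (by omega), show p - (p - i - v) = (v : ℕ) + i by omega,
      PowerSeries.coeff_X_pow_mul]
    exact auxSer_coeff _ _ _
  · have := v.2
    simp only [auxR, Sum.elim_inl, Sum.elim_inr]
    rw [auxPt_Z _ _ _ _ _ _ _ (by omega) (by omega),
      show p - (p - (e - i) - v) = (v : ℕ) + (e - i) by omega, PowerSeries.coeff_X_pow_mul]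
    exact auxSer_coeff _ _ _
  · have := v.2
    simp only [auxR, Sum.elim_inl, Sum.elim_inr]
    rw [auxPt_21 _ _ _ _ _ _ _ (by omega) (by omega)]
    unfold auxW auxWf
    rw [dif_pos (by omega)]
    simp

section
variable (k : Type*) [Field k]

def auxPhi (p e i : ℕ) :
    MvPolynomial (Fin 3 × Fin 3 × Fin p) k →ₐ[k] MvPolynomial (auxTau p e i) k :=
  MvPolynomial.aeval (auxQ p e i fun v => MvPolynomial.X v)

theorem auxPhi_eval (p e i : ℕ) (F : MvPolynomial (Fin 3 × Fin 3 × Fin p) k)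
    (t : auxTau p e i → k) :
    MvPolynomial.eval t (auxPhi k p e i F) = MvPolynomial.eval (auxQ p e i t) F := by
  have h : (MvPolynomial.eval t).comp (auxPhi k p e i).toRingHom =
      MvPolynomial.eval (auxQ p e i t) := by
    apply MvPolynomial.ringHom_ext
    · intro r
      simp [auxPhi]
    · intro z
      simp [auxPhi, auxQ_map]
  exact congrArg (fun f => f F) h

theorem aux_dim_i [Infinite k] (p e i : ℕ) (hp : 0 < p) (hi : i ≤ e) (he : e ≤ p) :
    ringKrullDim (MvPolynomial (Fin 3 × Fin 3 × Fin p) k ⧸ RingHom.ker (auxPhi k p e i)) =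
      ((3 * p : ℕ) : WithBot ℕ∞) := by
  have hprime : (RingHom.ker (auxPhi k p e i)).IsPrime := RingHom.ker_isPrime _
  have hcard : Fintype.card (auxTau p e i) = 3 * p := by
    simp only [auxTau, Fintype.card_sum, Fintype.card_fin]
    omega
  rw [← hcard]
  refine aux_dim_sandwich (MvPolynomial.aeval fun v =>
    Ideal.Quotient.mk (RingHom.ker (auxPhi k p e i)) (auxR p e i (fun z => MvPolynomial.X z) v)) ?_
    (Ideal.kerLiftAlg (auxPhi k p e i)) (Ideal.kerLiftAlg_injective _)
  rw [injective_iff_map_eq_zero]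
  intro F hF
  have h1 : ∀ t : auxTau p e i → k, MvPolynomial.eval (auxR p e i (auxQ p e i t)) F = 0 := by
    intro t
    have hkey : ∀ G, MvPolynomial.eval t (Ideal.kerLiftAlg (auxPhi k p e i)
        (Ideal.Quotient.mk (RingHom.ker (auxPhi k p e i)) G)) =
        MvPolynomial.eval (auxQ p e i t) G := fun G => auxPhi_eval k p e i G t
    have h : ((MvPolynomial.eval t).comp (Ideal.kerLiftAlg (auxPhi k p e i)).toRingHom).comp
        (MvPolynomial.aeval (R := k) fun v => Ideal.Quotient.mk (RingHom.ker (auxPhi k p e i))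
          (auxR p e i (fun z => MvPolynomial.X z) v)).toRingHom =
        MvPolynomial.eval (auxR p e i (auxQ p e i t)) := by
      apply MvPolynomial.ringHom_ext
      · intro r
        simp only [RingHom.comp_apply, AlgHom.toRingHom_eq_coe, RingHom.coe_coe,
          MvPolynomial.algHom_C, MvPolynomial.eval_C, MvPolynomial.algebraMap_eq, AlgHom.commutes]
      · intro v
        simp only [RingHom.comp_apply, AlgHom.toRingHom_eq_coe, RingHom.coe_coe,
          MvPolynomial.aeval_X, hkey, auxR_map, MvPolynomial.eval_X]
    rw [← h]
    simp only [RingHom.comp_apply, AlgHom.toRingHom_eq_coe, RingHom.coe_coe, hF, map_zero]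
  have h2 : F * MvPolynomial.X (Sum.inl ⟨0, hp⟩) = 0 := by
    apply MvPolynomial.funext
    intro u
    rw [map_mul, MvPolynomial.eval_X, map_zero]
    by_cases hu : u (Sum.inl ⟨0, hp⟩) = 0
    · rw [hu, mul_zero]
    · have h0 : PowerSeries.constantCoeff (auxB u) ≠ 0 := by
        rw [← PowerSeries.coeff_zero_eq_constantCoeff_apply]
        have := auxSer_coeff p (fun j => u (Sum.inl j)) ⟨0, hp⟩
        rw [auxB]
        exact fun h => hu (this.symm.trans h)
      have h3 := h1 (auxTOf p e i (auxB u) ((auxB u)⁻¹ * auxG u) (auxY u) (auxW u))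
      rw [auxQ_tof p e i hi he _ _ _ _ (fun t ht => by
        unfold auxW auxWf
        rw [dif_neg (by omega)]), ← mul_assoc (auxB u), PowerSeries.mul_inv_cancel _ h0, one_mul,
        auxR_pt p e i hi he] at h3
      rw [h3, zero_mul]
  exact (mul_eq_zero.1 h2).resolve_right (MvPolynomial.X_ne_zero _)

theorem aux_curve [Infinite k] (p e i : ℕ) (w : ℕ → k)
    (F : MvPolynomial (Fin 3 × Fin 3 × Fin p) k) :
    AuxCurve (fun α β γ δ : PowerSeries k => MvPolynomial.eval (auxPt p (PowerSeries.X ^ i * α)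
      (PowerSeries.X ^ (e - i) * β) γ (PowerSeries.X ^ e * δ) w) F = 0) := by
  intro a b c d h hh H
  have key : ∀ r : k, Polynomial.eval r (MvPolynomial.eval₂ Polynomial.C (auxPt p
      (PowerSeries.X ^ i * a) (PowerSeries.X ^ (e - i) * b) c (PowerSeries.X ^ e * d)
      (fun n => Polynomial.C (w n))) F) =
      MvPolynomial.eval (auxPt p (PowerSeries.X ^ i * auxEv r a)
      (PowerSeries.X ^ (e - i) * auxEv r b) (auxEv r c) (PowerSeries.X ^ e * auxEv r d) w) F := by
    intro r
    rw [← Polynomial.coe_evalRingHom, MvPolynomial.hom_eval₂]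
    have h1 : (Polynomial.evalRingHom r).comp Polynomial.C = RingHom.id k := by
      ext
      simp
    rw [h1, MvPolynomial.eval₂_id]
    have h2 : (Polynomial.evalRingHom r) ∘ (auxPt p
      (PowerSeries.X ^ i * a) (PowerSeries.X ^ (e - i) * b) c (PowerSeries.X ^ e * d)
      (fun n => Polynomial.C (w n))) = auxPt p (PowerSeries.X ^ i * auxEv r a)
      (PowerSeries.X ^ (e - i) * auxEv r b) (auxEv r c) (PowerSeries.X ^ e * auxEv r d) w := by
      funext z
      rw [Function.comp_apply, auxPt_map]
      simp only [map_mul, map_pow, PowerSeries.map_X, auxEv, Polynomial.coe_evalRingHom,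
        Polynomial.eval_C]
    exact congrArg (fun q => MvPolynomial.eval q F) h2
  have hQ : MvPolynomial.eval₂ Polynomial.C (auxPt p
      (PowerSeries.X ^ i * a) (PowerSeries.X ^ (e - i) * b) c (PowerSeries.X ^ e * d)
      (fun n => Polynomial.C (w n))) F * h = 0 := by
    apply Polynomial.funext
    intro r
    rw [Polynomial.eval_mul, key, Polynomial.eval_zero]
    by_cases hr : h.eval r = 0
    · rw [hr, mul_zero]
    · rw [H r hr, zero_mul]
  have hQ0 := (mul_eq_zero.1 hQ).resolve_right hh
  have := key 0
  rw [hQ0, Polynomial.eval_zero] at this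
  exact this.symm

theorem aux_base (p e i : ℕ) (hi : i ≤ e) (he : e ≤ p) (w : ℕ → k)
    (hw : ∀ t, e + 1 ≤ t → w t = 0)
    (F : MvPolynomial (Fin 3 × Fin 3 × Fin p) k) (hF : auxPhi k p e i F = 0) :
    AuxBase (p - e) (fun α β γ δ : PowerSeries k => MvPolynomial.eval (auxPt p
      (PowerSeries.X ^ i * α)
      (PowerSeries.X ^ (e - i) * β) γ (PowerSeries.X ^ e * δ) w) F = 0) := by
  intro a b c d hc hm
  have h := auxPhi_eval k p e i F (auxTOf p e i c (c⁻¹ * a) b w)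
  rw [hF, map_zero, auxQ_tof p e i hi he _ _ _ _ hw, ← mul_assoc c,
    PowerSeries.mul_inv_cancel _ hc, one_mul] at h
  rw [h]
  have : auxPt p (PowerSeries.X ^ i * a) (PowerSeries.X ^ (e - i) * b) c (PowerSeries.X ^ e * d) w =
      auxPt p (PowerSeries.X ^ i * a) (PowerSeries.X ^ (e - i) * b) c
        (PowerSeries.X ^ e * -(c⁻¹ * a * b)) w := by
    refine auxPt_congr p _ _ _ _ _ _ _ _ _ _ (by simp) (by simp) (by simp) ?_ (fun _ _ _ => rfl)
    rw [← mul_sub]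
    have h1 : d - -(c⁻¹ * a * b) = c⁻¹ * (a * b + c * d) := by
      have := PowerSeries.inv_mul_cancel c hc
      linear_combination (-d) * this
    rw [h1]
    refine dvd_trans ?_ (mul_dvd_mul_left _ (hm.mul_left _))
    rw [← pow_add]
    exact pow_dvd_pow _ (by omega)
  rw [this]

theorem aux_split (e : ℕ) (a y : PowerSeries k)
    (h : (PowerSeries.X : PowerSeries k) ^ e ∣ a * y) :
    ∃ i, i ≤ e ∧ (PowerSeries.X : PowerSeries k) ^ i ∣ a ∧
      (PowerSeries.X : PowerSeries k) ^ (e - i) ∣ y := by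
  obtain ⟨d1, d2, h1, h2, h3⟩ := exists_dvd_and_dvd_of_dvd_mul h
  obtain ⟨i, hi, u, hu⟩ := (dvd_prime_pow PowerSeries.X_prime e).1 (Dvd.intro _ h3.symm)
  refine ⟨i, hi, ?_, ?_⟩
  · rw [← hu]
    exact (Units.mul_right_dvd).2 h1
  · refine dvd_trans ?_ h2
    refine ⟨u, ?_⟩
    have hX : (PowerSeries.X : PowerSeries k) ^ i ≠ 0 := pow_ne_zero _ PowerSeries.X_ne_zero
    refine mul_left_cancel₀ hX ?_
    rw [← mul_assoc, ← pow_add, show i + (e - i) = e by omega, h3, ← hu]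
    ring

theorem aux_union [Infinite k] (p e : ℕ) (he : e ≤ p) :
    W2s k 3 p (e + 1) = ⋃ i : Fin (e + 1), MvPolynomial.zeroLocus k
      (RingHom.ker (auxPhi k p e i)) := by
  ext x
  rw [Set.mem_iUnion]
  constructor
  · intro hx
    obtain ⟨a, y, b, c, w, rfl, hw, hc, hm⟩ := aux_of_mem_W p (e + 1) (by omega) (by omega) x hx
    rw [Nat.add_sub_cancel] at hc
    have h1 : (PowerSeries.X : PowerSeries k) ^ e ∣ a * y :=
      (dvd_add_left (hc.mul_left b)).1 ((pow_dvd_pow _ he).trans hm)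
    obtain ⟨i, hi, ⟨α, rfl⟩, ⟨β, rfl⟩⟩ := aux_split k e a y h1
    obtain ⟨δ, rfl⟩ := hc
    refine ⟨⟨i, by omega⟩, ?_⟩
    rw [MvPolynomial.mem_zeroLocus_iff]
    intro F hF
    have hm' : (PowerSeries.X : PowerSeries k) ^ (p - e) ∣ α * β + b * δ := by
      have hX : (PowerSeries.X : PowerSeries k) ^ e ≠ 0 := pow_ne_zero _ PowerSeries.X_ne_zero
      rw [← mul_dvd_mul_iff_left hX, ← pow_add, show e + (p - e) = p by omega]
      have h2 : (PowerSeries.X : PowerSeries k) ^ e * (α * β + b * δ) =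
          PowerSeries.X ^ i * α * (PowerSeries.X ^ (e - i) * β) + b * (PowerSeries.X ^ e * δ) := by
        have : (PowerSeries.X : PowerSeries k) ^ e = PowerSeries.X ^ i * PowerSeries.X ^ (e - i) := by
          rw [← pow_add, show i + (e - i) = e by omega]
        rw [this]
        ring
      rw [h2]
      exact hm
    have := aux_dense (aux_curve k p e i w F) (aux_base k p e i hi he w hw F hF) α β b δ hm'
    simpa using this
  · rintro ⟨i, hi⟩
    rw [MvPolynomial.mem_zeroLocus_iff] at hi
    have h1 : (fun z => (auxPhi k p e i).toRingHom (MvPolynomial.X z)) ∈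
        W2s (MvPolynomial (auxTau p e i) k) 3 p (e + 1) := by
      have h2 : (fun z => (auxPhi k p e i).toRingHom (MvPolynomial.X z)) =
          auxQ p e i fun v => MvPolynomial.X v := by
        funext z
        simp [auxPhi]
      rw [h2]
      refine aux_mem_W p (e + 1) (by omega) (by omega) _ _ _ _ _ ?_ ?_ ?_
      · intro t ht
        unfold auxW auxWf
        rw [dif_neg (by omega)]
      · rw [Nat.add_sub_cancel]
        exact Dvd.intro _ rfl
      · have hi2 := i.2
        generalize auxB (fun v : auxTau p e i => (MvPolynomial.X v : MvPolynomial (auxTau p e i) k)) = B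
        generalize auxG (fun v : auxTau p e i => (MvPolynomial.X v : MvPolynomial (auxTau p e i) k)) = G
        generalize auxY (fun v : auxTau p e i => (MvPolynomial.X v : MvPolynomial (auxTau p e i) k)) = Y
        have : ∀ Q : PowerSeries (MvPolynomial (auxTau p e i) k), Q ^ e = Q ^ (i : ℕ) * Q ^ (e - i) := by
          intro Q
          rw [← pow_add, show (i : ℕ) + (e - i) = e by omega]
        rw [this]
        refine ⟨0, ?_⟩
        ring
    have h3 := aux_W_transfer (auxPhi k p e i).toRingHom (MvPolynomial.eval x)
      (fun F hF => by simpa using hi F hF) p (e + 1) _ h1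
    simpa using h3
end

/-- For `Y_p(gl_3)` with `p > 2` and `2 ≤ s ≤ p+1`, the subvariety `W_{2s}` of `GTs₁`
is equidimensional of dimension `3p`. -/
theorem W2s_equidim (k : Type*) [Field k] [IsAlgClosed k] [CharZero k]
    (p : ℕ) (hp : 2 < p) (s : ℕ) (hs1 : 2 ≤ s) (hs2 : s ≤ p + 1) :
    IsEquidimOfDim k (Fin 3 × Fin 3 × Fin p) (W2s k 3 p s) (3 * p) := by
  obtain ⟨e, rfl⟩ : ∃ e, s = e + 1 := ⟨s - 1, by omega⟩
  exact aux_equidim _ (fun i : Fin (e + 1) => RingHom.ker (auxPhi k p e i))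
    (fun i => RingHom.ker_isPrime _) (aux_union k p e (by omega)) (3 * p)
    (fun i => aux_dim_i k p e i (by omega) (by omega) (by omega))

end
end

section
/- For the restricted Yangian Y_p(gl_3) with p > 2, the subvariety W_2 := ∪_{s=2}^{p+1} W_{2s} of GTs_1 is equidimensional of dimension 3p, i.e., every irreducible component of W_2 has Krull dimension 3p. -/
open scoped Classical

noncomputable section



section General
open MvPolynomial Topology

attribute [local instance] zariskiTopology

variable {k : Type*} [Field k] {σ : Type*}

theorem z_inducing : IsInducing (pointToPoint (σ := σ) (k := k) (K := k)) := by
  constructor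
  rw [PrimeSpectrum.isTopologicalBasis_basic_opens.eq_generateFrom, induced_generateFrom_eq]
  unfold zariskiTopology
  congr 1
  ext U
  constructor
  · rintro ⟨f, rfl⟩
    refine ⟨_, ⟨f, rfl⟩, ?_⟩
    ext x
    simp [pointToPoint]
  · rintro ⟨_, ⟨f, rfl⟩, rfl⟩
    refine ⟨f, ?_⟩
    ext x
    simp [pointToPoint]

theorem z_isClosed_zeroLocus (I : Ideal (MvPolynomial σ k)) : IsClosed (zeroLocus k I) := by
  rw [z_inducing.isClosed_iff]
  refine ⟨PrimeSpectrum.zeroLocus I, PrimeSpectrum.isClosed_zeroLocus _, ?_⟩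
  ext x
  simp only [Set.mem_preimage, PrimeSpectrum.mem_zeroLocus, pointToPoint, mem_zeroLocus_iff]
  constructor
  · intro h f hf
    exact (mem_vanishingIdeal_singleton_iff x f).1 (h hf)
  · intro h f hf
    exact (mem_vanishingIdeal_singleton_iff x f).2 (h f hf)

theorem z_isClosed_iff {V : Set (σ → k)} :
    IsClosed V ↔ zeroLocus k (vanishingIdeal k V) = V := by
  constructor
  · intro h
    rw [z_inducing.isClosed_iff] at h
    obtain ⟨t, ht, rfl⟩ := h
    obtain ⟨I, rfl⟩ := (PrimeSpectrum.isClosed_iff_zeroLocus_ideal _).1 ht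
    refine le_antisymm ?_ (zeroLocus_vanishingIdeal_le _)
    intro x hx
    simp only [Set.mem_preimage, PrimeSpectrum.mem_zeroLocus, pointToPoint]
    intro f hf
    refine (mem_vanishingIdeal_singleton_iff x f).2 (hx f ?_)
    intro y hy
    exact (mem_vanishingIdeal_singleton_iff y f).1 (hy hf)
  · intro h
    rw [← h]
    exact z_isClosed_zeroLocus _

theorem z_irred_iff {V : Set (σ → k)} :
    IsIrreducible V ↔ (vanishingIdeal k V).IsPrime := by
  constructor
  · rintro ⟨⟨x, hx⟩, h⟩
    refine ⟨?_, ?_⟩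
    · intro h1
      have : (1 : MvPolynomial σ k) ∈ vanishingIdeal k V := h1 ▸ trivial
      simpa using this x hx
    · intro f g hfg
      by_contra! hcon
      obtain ⟨hf, hg⟩ := hcon
      simp only [mem_vanishingIdeal_iff, not_forall] at hf hg
      obtain ⟨a, ha, hfa⟩ := hf
      obtain ⟨b, hb, hgb⟩ := hg
      have op : ∀ f : MvPolynomial σ k, IsOpen {x : σ → k | MvPolynomial.eval x f ≠ 0} :=
        fun f => TopologicalSpace.isOpen_generateFrom_of_mem ⟨f, rfl⟩
      obtain ⟨z, hz, h1, h2⟩ := h _ _ (op f) (op g) ⟨a, ha, by simpa using hfa⟩ ⟨b, hb, by simpa using hgb⟩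
      have := hfg z hz
      simp at this
      tauto
  · intro h
    refine ⟨?_, ?_⟩
    · by_contra hne
      rw [Set.not_nonempty_iff_eq_empty] at hne
      subst hne
      exact h.ne_top vanishingIdeal_empty
    · have := (PrimeSpectrum.isIrreducible_iff_vanishingIdeal_isPrime
        (s := pointToPoint (k := k) '' V)).2 (by rwa [vanishingIdeal_pointToPoint])
      intro u v hu hv hxu hyv
      obtain ⟨u, hu', rfl⟩ := z_inducing.isOpen_iff.1 hu
      obtain ⟨v, hv', rfl⟩ := z_inducing.isOpen_iff.1 hv
      obtain ⟨a, ha, hau⟩ := hxu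
      obtain ⟨b, hb, hbv⟩ := hyv
      obtain ⟨_, ⟨z, hz, rfl⟩, h1, h2⟩ := this.2 u v hu' hv' ⟨_, ⟨a, ha, rfl⟩, hau⟩ ⟨_, ⟨b, hb, rfl⟩, hbv⟩
      exact ⟨z, hz, h1, h2⟩

theorem ringKrullDim_le_of_integral {A B : Type*} [CommRing A] [CommRing B] (f : A →+* B)
    (hf : f.IsIntegral) : ringKrullDim B ≤ ringKrullDim A := by
  algebraize [f]
  refine Order.krullDim_le_of_strictMono (fun P => PrimeSpectrum.comap f P) ?_
  intro P Q h
  have : P.asIdeal < Q.asIdeal := h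
  have := Ideal.IsIntegral.comap_lt_comap (R := A) this
  exact this

theorem dim_image {τ : Type*} [Fintype τ] [Finite σ] (φ : MvPolynomial σ k →ₐ[k] MvPolynomial τ k) :
    ringKrullDim (MvPolynomial σ k ⧸ RingHom.ker φ) ≤ (Fintype.card τ : ℕ) := by
  have : Nontrivial (MvPolynomial σ k ⧸ RingHom.ker φ) :=
    Ideal.Quotient.nontrivial_iff.2 (RingHom.ker_ne_top _)
  obtain ⟨d, g, hg, hint⟩ := exists_integral_inj_algHom_of_fg k (MvPolynomial σ k ⧸ RingHom.ker φ)
  refine (ringKrullDim_le_of_integral _ hint).trans ?_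
  rw [MvPolynomial.ringKrullDim_of_isNoetherianRing, ringKrullDim_eq_zero_of_field, zero_add]
  have hinj : Function.Injective ((Ideal.kerLiftAlg φ).comp g) :=
    (Ideal.kerLiftAlg_injective φ).comp hg
  have := lift_trdeg_le_of_injective _ hinj
  rw [MvPolynomial.trdeg_of_isDomain, MvPolynomial.trdeg_of_isDomain] at this
  simp at this
  rw [Nat.card_eq_fintype_card, Fintype.card_fin]
  exact_mod_cast this

theorem dim_upper {Y : Type*} [TopologicalSpace Y]
    (J : Ideal (MvPolynomial σ k)) (f : Y → (σ → k)) (hf : IsInducing f)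
    (h : ∀ y, f y ∈ zeroLocus k J) :
    topologicalKrullDim Y ≤ ringKrullDim (MvPolynomial σ k ⧸ J) := by
  rw [← PrimeSpectrum.topologicalKrullDim_eq_ringKrullDim]
  have key : ∀ y, ∃ Q : PrimeSpectrum (MvPolynomial σ k ⧸ J),
      PrimeSpectrum.comap (Ideal.Quotient.mk J) Q = pointToPoint (f y) := by
    intro y
    have : pointToPoint (f y) ∈ PrimeSpectrum.zeroLocus (J : Set (MvPolynomial σ k)) := by
      rw [PrimeSpectrum.mem_zeroLocus]
      intro g hg
      exact (mem_vanishingIdeal_singleton_iff (f y) g).2 (h y g hg)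
    have h2 := range_comap_of_surjective _ (Ideal.Quotient.mk J) Ideal.Quotient.mk_surjective
    rw [Ideal.mk_ker] at h2
    rw [← h2] at this
    exact this
  choose q hq using key
  have hemb := PrimeSpectrum.isClosedEmbedding_comap_of_surjective _ (Ideal.Quotient.mk J)
      Ideal.Quotient.mk_surjective
  have : IsInducing q := by
    rw [← hemb.isInducing.of_comp_iff]
    have : PrimeSpectrum.comap (Ideal.Quotient.mk J) ∘ q = pointToPoint ∘ f := funext hq
    rw [this]
    exact z_inducing.comp hf
  exact this.topologicalKrullDim_le

theorem height_point [IsAlgClosed k] [Fintype σ] (x : σ → k) :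
    (vanishingIdeal k {x} : Ideal (MvPolynomial σ k)).height = (Fintype.card σ : ℕ) := by
  have hd : ringKrullDim (MvPolynomial σ k) = (Fintype.card σ : ℕ) := by
    rw [MvPolynomial.ringKrullDim_of_isNoetherianRing, ringKrullDim_eq_zero_of_field, zero_add,
      Nat.card_eq_fintype_card]
  have : FiniteRingKrullDim (MvPolynomial σ k) := by
    rw [finiteRingKrullDim_iff_ne_bot_and_top, hd]
    exact ⟨by simp, WithBot.coe_inj.not.2 (ENat.natCast_ne_top _)⟩
  obtain ⟨m, hm, hh⟩ := Ideal.exists_isMaximal_height (R := MvPolynomial σ k)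
  rw [hd] at hh
  obtain ⟨y, rfl⟩ := isMaximal_iff_eq_vanishingIdeal_singleton.1 hm
  have hh' : (vanishingIdeal k {y} : Ideal (MvPolynomial σ k)).height = (Fintype.card σ : ℕ) := by
    exact_mod_cast hh
  rw [← hh']
  let T : (σ → k) → (MvPolynomial σ k →ₐ[k] MvPolynomial σ k) := fun a => aeval (fun i => X i + C (a i))
  have hT : ∀ a, (T (-a)).comp (T a) = AlgHom.id _ _ := by
    intro a
    ext i
    simp [T, algHom_C, algebraMap_eq]
  let e : MvPolynomial σ k ≃ₐ[k] MvPolynomial σ k :=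
    AlgEquiv.ofAlgHom (T (x - y)) (T (-(x-y))) (by have := hT (-(x-y)); rwa [neg_neg] at this) (hT _)
  rw [← RingEquiv.height_comap e.toRingEquiv (vanishingIdeal k {y})]
  symm
  congr 1
  ext g
  rw [Ideal.mem_comap, mem_vanishingIdeal_singleton_iff, mem_vanishingIdeal_singleton_iff]
  have : aeval y (e.toRingEquiv g) = aeval x g := by
    change aeval y (T (x-y) g) = _
    rw [← AlgHom.comp_apply]
    congr 1
    ext i
    simp [T]
  rw [this]

theorem dim_lower [IsAlgClosed k] [Fintype σ] {ι : Type*} [Fintype ι] (F : ι → MvPolynomial σ k)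
    {Y : Type*} [TopologicalSpace Y] (f : Y → (σ → k)) (hf : IsInducing f)
    (hcl : IsClosed (Set.range f)) (hirr : IsIrreducible (Set.range f))
    (hsub : Set.range f ⊆ zeroLocus k (Ideal.span (Set.range F)))
    (hmax : ∀ D : Set (σ → k), IsClosed D → IsIrreducible D →
      D ⊆ zeroLocus k (Ideal.span (Set.range F)) → Set.range f ⊆ D → D ⊆ Set.range f)
    (n : ℕ) (hn : n + Fintype.card ι ≤ Fintype.card σ) :
    (n : WithBot ℕ∞) ≤ topologicalKrullDim Y := by
  set I := Ideal.span (Set.range F) with hI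
  set P := vanishingIdeal k (Set.range f) with hP
  have hPp : P.IsPrime := z_irred_iff.1 hirr
  have hZP : zeroLocus k P = Set.range f := z_isClosed_iff.1 hcl
  have hIP : I ≤ P := le_zeroLocus_iff_le_vanishingIdeal.1 hsub
  -- minimality
  have hmin : ∀ Q : Ideal (MvPolynomial σ k), Q.IsPrime → I ≤ Q → Q ≤ P → Q = P := by
    intro Q hQ h1 h2
    refine le_antisymm h2 ?_
    have hQv := MvPolynomial.IsPrime.vanishingIdeal_zeroLocus (K := k) Q
    have := hmax (zeroLocus k Q) (z_isClosed_zeroLocus _) (z_irred_iff.2 (by rwa [hQv]))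
      (zeroLocus_anti_mono h1) (by rw [← hZP]; exact zeroLocus_anti_mono h2)
    rw [← hZP] at this
    have h3 := vanishingIdeal_anti_mono (k := k) this
    rw [hQv] at h3
    exact (le_vanishingIdeal_zeroLocus _).trans h3
  have hfin : (I.minimalPrimes).Finite := Ideal.finite_minimalPrimes_of_isNoetherianRing _ I
  -- a good point
  obtain ⟨x, hx, hxgood⟩ : ∃ x ∈ Set.range f, ∀ Q : Ideal (MvPolynomial σ k), Q.IsPrime → I ≤ Q →
      Q ≤ vanishingIdeal k {x} → P ≤ Q := by
    let S := (hfin.sdiff (t := {P})).toFinset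
    have h1 : ¬ S.inf id ≤ P := by
      intro h
      rw [Ideal.IsPrime.inf_le' hPp] at h
      obtain ⟨Q, hQ, hle⟩ := h
      simp [S] at hQ
      exact hQ.2 (hmin Q hQ.1.1.1 hQ.1.1.2 hle)
    obtain ⟨g, hg, hgP⟩ := SetLike.not_le_iff_exists.1 h1
    rw [hP, mem_vanishingIdeal_iff] at hgP
    push Not at hgP
    obtain ⟨x, hx, hgx⟩ := hgP
    refine ⟨x, hx, ?_⟩
    intro Q hQ hIQ hQx
    obtain ⟨Q', hQ', hle⟩ := Ideal.exists_minimalPrimes_le hIQ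
    by_cases hQP : Q' = P
    · rwa [← hQP]
    · exfalso
      apply hgx
      rw [← mem_vanishingIdeal_singleton_iff]
      apply hQx
      apply hle
      have : S.inf id ≤ Q' := Finset.inf_le (f := id) (by simp [S]; exact ⟨hQ', hQP⟩)
      exact this hg
  set M := (vanishingIdeal k {x} : Ideal (MvPolynomial σ k)) with hM
  have hPM : P ≤ M := vanishingIdeal_anti_mono (by simpa using hx)
  have hIM : I ≤ M := hIP.trans hPM
  have hht := Ideal.height_le_height_add_encard_of_subset (Set.range F) (p := M)
    ((Ideal.subset_span).trans hIM)
  rw [height_point] at hht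
  have hcard : (Set.range F).encard ≤ (Fintype.card ι : ℕ) := by
    rw [← Set.image_univ]
    refine (Set.encard_image_le _ _).trans ?_
    simp
  have hht2 : (n : ℕ∞) ≤ (M.map (Ideal.Quotient.mk I)).height := by
    have h3 : ((n + Fintype.card ι : ℕ) : ℕ∞) ≤ (M.map (Ideal.Quotient.mk I)).height + (Fintype.card ι : ℕ) := by
      refine le_trans (by exact_mod_cast hn) (hht.trans ?_)
      gcongr
    push_cast at h3
    exact (ENat.add_le_add_iff_right (ENat.natCast_ne_top _)).1 h3
  have hMp : (M.map (Ideal.Quotient.mk I)).IsPrime :=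
    Ideal.map_isPrime_of_surjective Ideal.Quotient.mk_surjective (by rwa [Ideal.mk_ker])
  obtain ⟨l, hl1, hl2⟩ : ∃ l : LTSeries (PrimeSpectrum (MvPolynomial σ k ⧸ I)),
      l.last = ⟨_, hMp⟩ ∧ l.length = n := by
    have : (n : ℕ∞) ≤ Order.height (⟨_, hMp⟩ : PrimeSpectrum (MvPolynomial σ k ⧸ I)) := by
      rw [← PrimeSpectrum.height_eq_orderHeight]; exact hht2
    exact Order.exists_series_of_le_height _ this
  have hcm : Ideal.comap (Ideal.Quotient.mk I) (M.map (Ideal.Quotient.mk I)) = M := by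
    rw [Ideal.comap_map_of_surjective _ Ideal.Quotient.mk_surjective, ← RingHom.ker_eq_comap_bot,
      Ideal.mk_ker, sup_eq_left.2 hIM]
  let q : Fin (l.length + 1) → Ideal (MvPolynomial σ k) :=
    fun i => (l i).asIdeal.comap (Ideal.Quotient.mk I)
  have hqp : ∀ i, (q i).IsPrime := fun i => inferInstance
  have hqI : ∀ i, I ≤ q i := by
    intro i
    have := Ideal.ker_le_comap (K := (l i).asIdeal) (Ideal.Quotient.mk I)
    rwa [Ideal.mk_ker] at this
  have hqM : ∀ i, q i ≤ M := by
    intro i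
    rw [← hcm]
    apply Ideal.comap_mono
    have : l i ≤ l.last := LTSeries.monotone _ (Fin.le_last i)
    rw [hl1] at this
    exact this
  have hqP : ∀ i, P ≤ q i := fun i => hxgood _ (hqp i) (hqI i) (hqM i)
  have hqlt : ∀ i j, i < j → q i < q j := by
    intro i j hij
    have : l i < l j := LTSeries.strictMono l hij
    have : (l i).asIdeal < (l j).asIdeal := this
    refine lt_of_le_of_ne (Ideal.comap_mono this.le) ?_
    intro h
    exact this.ne (Ideal.comap_injective_of_surjective _ Ideal.Quotient.mk_surjective h)
  have hZ : ∀ i, zeroLocus k (q i) ⊆ Set.range f := fun i => by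
    rw [← hZP]; exact zeroLocus_anti_mono (hqP i)
  let Zi : Fin (l.length + 1) → TopologicalSpace.IrreducibleCloseds Y := fun i =>
    { carrier := f ⁻¹' zeroLocus k (q i)
      isClosed' := (z_isClosed_zeroLocus _).preimage hf.continuous
      isIrreducible' := by
        have hir : IsIrreducible (zeroLocus k (q i)) :=
          z_irred_iff.2 (by rw [MvPolynomial.IsPrime.vanishingIdeal_zeroLocus]; exact hqp i)
        refine ⟨?_, ?_⟩
        · obtain ⟨z, hz⟩ := hir.1
          obtain ⟨y, rfl⟩ := hZ i hz
          exact ⟨y, hz⟩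
        · intro u v hu hv hxu hyv
          obtain ⟨u, hu', rfl⟩ := hf.isOpen_iff.1 hu
          obtain ⟨v, hv', rfl⟩ := hf.isOpen_iff.1 hv
          obtain ⟨a, ha, hau⟩ := hxu
          obtain ⟨b, hb, hbv⟩ := hyv
          obtain ⟨z, hz, h1, h2⟩ := hir.2 u v hu' hv' ⟨_, ha, hau⟩ ⟨_, hb, hbv⟩
          obtain ⟨y, rfl⟩ := hZ i hz
          exact ⟨y, hz, h1, h2⟩ }
  have hZle : ∀ i j, Zi i ≤ Zi j → q j ≤ q i := by
    intro i j hij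
    have h1 : zeroLocus k (q i) ⊆ zeroLocus k (q j) := by
      intro z hz
      obtain ⟨y, rfl⟩ := hZ i hz
      exact hij hz
    have h2 := vanishingIdeal_anti_mono (k := k) h1
    rwa [MvPolynomial.IsPrime.vanishingIdeal_zeroLocus, MvPolynomial.IsPrime.vanishingIdeal_zeroLocus] at h2
  have hanti : ∀ i j, i < j → Zi j < Zi i := by
    intro i j hij
    refine lt_of_le_not_ge ?_ ?_
    · intro y hy
      exact zeroLocus_anti_mono (hqlt i j hij).le hy
    · intro h
      exact (hqlt i j hij).not_ge (hZle _ _ h)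
  let L : LTSeries (TopologicalSpace.IrreducibleCloseds Y) :=
    { length := l.length
      toFun := fun i => Zi (Fin.rev i)
      step := fun i => hanti _ _ (Fin.rev_lt_rev.2 (by simp)) }
  have : (L.length : WithBot ℕ∞) ≤ Order.krullDim _ := Order.le_krullDim_iff.2 ⟨L, rfl⟩
  rw [← hl2]
  exact this

theorem equidim_of [IsAlgClosed k] [Fintype σ] {S : Type*} (T : Finset S) (d : ℕ)
    (Vs : S → Set (σ → k)) (ι : S → Type) [∀ s, Fintype (ι s)]
    (F : ∀ s, ι s → MvPolynomial σ k)
    (hV : ∀ s ∈ T, Vs s = zeroLocus k (Ideal.span (Set.range (F s))))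
    (hcard : ∀ s ∈ T, d + Fintype.card (ι s) ≤ Fintype.card σ)
    (hup : ∀ s ∈ T, ∃ J : Finset (Ideal (MvPolynomial σ k)),
      (∀ x ∈ Vs s, ∃ I ∈ J, x ∈ zeroLocus k I) ∧
      ∀ I ∈ J, ringKrullDim (MvPolynomial σ k ⧸ I) ≤ (d : WithBot ℕ∞)) :
    IsEquidimOfDim k σ (⋃ s ∈ T, Vs s) d := by
  obtain ⟨V, hVdef⟩ : ∃ V, V = ⋃ s ∈ T, Vs s := ⟨_, rfl⟩
  rw [← hVdef]
  intro C hC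
  change C ∈ irreducibleComponents V at hC
  change topologicalKrullDim C = d
  have hVscl : ∀ s ∈ T, IsClosed (Vs s) := fun s hs => by
    rw [hV s hs]; exact z_isClosed_zeroLocus _
  have hVcl : IsClosed V := by
    rw [hVdef]
    exact T.finite_toSet.isClosed_biUnion hVscl
  let f : C → (σ → k) := fun c => c.1.1
  have hf : IsInducing f := IsInducing.subtypeVal.comp IsInducing.subtypeVal
  have hran : Set.range f = Subtype.val '' C := by
    ext x
    simp [f]
  have hcl : IsClosed (Set.range f) := by
    rw [hran]
    exact hVcl.isClosedEmbedding_subtypeVal.isClosedMap _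
      (isClosed_of_mem_irreducibleComponents C hC)
  have hirr : IsIrreducible (Set.range f) := by
    rw [hran]
    exact hC.1.image _ continuous_subtype_val.continuousOn
  have hsubV : Set.range f ⊆ V := by
    rintro _ ⟨c, rfl⟩
    exact c.1.2
  obtain ⟨s, hs, hsub⟩ : ∃ s ∈ T, Set.range f ⊆ Vs s := by
    obtain ⟨z, hz, hz'⟩ := isIrreducible_iff_sUnion_isClosed.1 hirr (T.image Vs)
      (by intro z hz; obtain ⟨s, hs, rfl⟩ := Finset.mem_image.1 hz; exact hVscl s hs)
      (by
        intro x hx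
        obtain ⟨s, hs, hx'⟩ := Set.mem_iUnion₂.1 (hVdef ▸ hsubV hx)
        exact ⟨Vs s, by simpa using ⟨s, hs, rfl⟩, hx'⟩)
    obtain ⟨s, hs, rfl⟩ := Finset.mem_image.1 hz
    exact ⟨s, hs, hz'⟩
  apply le_antisymm
  · obtain ⟨J, hJ1, hJ2⟩ := hup s hs
    obtain ⟨z, hz, hz'⟩ := isIrreducible_iff_sUnion_isClosed.1 hirr
      (J.image (fun I => zeroLocus k I))
      (by
        intro z hz; obtain ⟨s, hs, rfl⟩ := Finset.mem_image.1 hz; exact z_isClosed_zeroLocus _)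
      (by
        intro x hx
        obtain ⟨I, hI, hx'⟩ := hJ1 x (hsub hx)
        exact ⟨zeroLocus k I, by simpa using ⟨I, hI, rfl⟩, hx'⟩)
    obtain ⟨I, hI, rfl⟩ := Finset.mem_image.1 hz
    exact (dim_upper I f hf (fun y => hz' ⟨y, rfl⟩)).trans (hJ2 I hI)
  · refine dim_lower (F s) f hf hcl hirr (by rw [← hV s hs]; exact hsub) ?_ d (hcard s hs)
    intro D hDc hDi hDs hfD
    rw [← hV s hs] at hDs
    have hDV : D ⊆ V := fun x hx => hVdef ▸ Set.mem_biUnion hs (hDs hx)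
    have hDi' : IsIrreducible (Subtype.val ⁻¹' D : Set V) := by
      refine ⟨?_, ?_⟩
      · obtain ⟨x, hx⟩ := hDi.1
        exact ⟨⟨x, hDV hx⟩, hx⟩
      · intro u v hu hv hxu hyv
        obtain ⟨u, hu', rfl⟩ := isOpen_induced_iff.1 hu
        obtain ⟨v, hv', rfl⟩ := isOpen_induced_iff.1 hv
        obtain ⟨a, ha, hau⟩ := hxu
        obtain ⟨b, hb, hbv⟩ := hyv
        obtain ⟨z, hz, h1, h2⟩ := hDi.2 u v hu' hv' ⟨_, ha, hau⟩ ⟨_, hb, hbv⟩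
        exact ⟨⟨z, hDV hz⟩, hz, h1, h2⟩
    have hle : (Subtype.val ⁻¹' D : Set V) ⊆ C := hC.2 hDi' (by
      intro c hc
      exact hfD ⟨⟨c, hc⟩, rfl⟩)
    intro x hx
    rw [hran]
    exact ⟨⟨x, hDV hx⟩, hle hx, rfl⟩

end General

section Part3
open MvPolynomial

theorem map_xvn {R S : Type*} [CommRing R] [CommRing S] (f : R →+* S) (n p : ℕ)
    (x : Fin n × Fin n × Fin p → R) (a b t : ℕ) :
    f (xvn R n p x a b t) = xvn S n p (fun i => f (x i)) a b t := by
  unfold xvn; split_ifs <;> simp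

theorem map_P3v {R S : Type*} [CommRing R] [CommRing S] (f : R →+* S) (n p : ℕ)
    (x : Fin n × Fin n × Fin p → R) (i : ℕ) :
    f (P3v R n p x i) = P3v S n p (fun i => f (x i)) i := by
  unfold P3v Tv; split_ifs <;> simp [map_xvn]

/-- Index type of the equations of `W2s`. -/
abbrev EqIdx (p s : ℕ) : Type := (Fin 3 × Fin p) ⊕ Fin (2 * p) ⊕ Fin (p + 1 - s) ⊕ Fin (s - 1)

/-- The equations of `W2s`. -/
def eqW (k : Type*) [Field k] (p s : ℕ) :
    EqIdx p s → MvPolynomial (Fin 3 × Fin 3 × Fin p) k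
  | Sum.inl (a, t) => xvn _ 3 p X (![1, 1, 2] a) (![1, 2, 2] a) (t + 1)
  | Sum.inr (Sum.inl j) => P3v _ 3 p X (j + 1)
  | Sum.inr (Sum.inr (Sum.inl j)) => xvn _ 3 p X 2 1 (s + j)
  | Sum.inr (Sum.inr (Sum.inr j)) => xvn _ 3 p X 3 2 (p + 2 - s + j)

theorem W2s_eq (k : Type*) [Field k] (p s : ℕ) (hs : 2 ≤ s) (hs' : s ≤ p + 1) :
    W2s k 3 p s = zeroLocus k (Ideal.span (Set.range (eqW k p s))) := by
  ext x
  have hx : ∀ a b t, aeval x (xvn (MvPolynomial (Fin 3 × Fin 3 × Fin p) k) 3 p X a b t)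
      = xvn k 3 p x a b t := by
    intro a b t
    have := map_xvn (aeval (R := k) x : MvPolynomial (Fin 3 × Fin 3 × Fin p) k →ₐ[k] k).toRingHom
      3 p X a b t
    simpa using this
  have hP : ∀ t, aeval x (P3v (MvPolynomial (Fin 3 × Fin 3 × Fin p) k) 3 p X t)
      = P3v k 3 p x t := by
    intro t
    have := map_P3v (aeval (R := k) x : MvPolynomial (Fin 3 × Fin 3 × Fin p) k →ₐ[k] k).toRingHom
      3 p X t
    simpa using this
  rw [zeroLocus_span]
  simp only [W2s, Set.mem_ofPred_eq, Set.forall_mem_range]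
  constructor
  · rintro ⟨h1, h2, h3, h4, -⟩ i
    rcases i with ⟨a, t⟩ | j | j | j
    · have := h1 (t + 1) (by omega) (by omega)
      fin_cases a <;> simp [eqW, hx, this]
    · simp only [eqW, hP]
      exact h2 _ (by omega) (by omega)
    · simp only [eqW, hx]
      exact h3 _ (by omega) (by omega)
    · simp only [eqW, hx]
      exact h4 _ (by omega) (by omega)
  · intro h
    refine ⟨fun t ht ht' => ?_, fun j hj hj' => ?_, fun t ht ht' => ?_, fun t ht ht' => ?_,
      fun m j hm hm' => by omega⟩
    · have e : t - 1 + 1 = t := by omega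
      have h0 := h (Sum.inl (0, ⟨t - 1, by omega⟩))
      have h1 := h (Sum.inl (1, ⟨t - 1, by omega⟩))
      have h2 := h (Sum.inl (2, ⟨t - 1, by omega⟩))
      simp [eqW, hx, e] at h0 h1 h2
      exact ⟨h0, h1, h2⟩
    · have h0 := h (Sum.inr (Sum.inl ⟨j - 1, by omega⟩))
      have e : j - 1 + 1 = j := by omega
      simpa [eqW, hP, e] using h0
    · have h0 := h (Sum.inr (Sum.inr (Sum.inl ⟨t - s, by omega⟩)))
      have e : s + (t - s) = t := by omega
      simpa [eqW, hx, e] using h0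
    · have h0 := h (Sum.inr (Sum.inr (Sum.inr ⟨t - (p + 2 - s), by omega⟩)))
      have e : p + 2 - s + (t - (p + 2 - s)) = t := by omega
      simpa [eqW, hx, e] using h0

/-- Point with prescribed coordinate functions. -/
def mkPt (R : Type*) [CommRing R] (p : ℕ) (A B C D E G : ℕ → R) :
    Fin 3 × Fin 3 × Fin p → R := fun i =>
  (![![0, 0, A], ![E, 0, B], ![C, D, G]] i.1 i.2.1 : ℕ → R) (i.2.2 + 1)

section mk
variable {R : Type*} [CommRing R] {p : ℕ} (A B C D E G : ℕ → R) (t : ℕ)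
theorem xvn_mk (a b : ℕ) (ha : a < 3) (hb : b < 3) :
    xvn R 3 p (mkPt R p A B C D E G) (a + 1) (b + 1) t = if 1 ≤ t ∧ t ≤ p then
    (![![0, 0, A], ![E, 0, B], ![C, D, G]] ⟨a, ha⟩ ⟨b, hb⟩ : ℕ → R) t else 0 := by
  unfold xvn mkPt
  by_cases h : 1 ≤ t ∧ t ≤ p
  · rw [dif_pos ⟨by omega, by omega, by omega, by omega, h.1, h.2⟩, if_pos h]
    have : t - 1 + 1 = t := by omega
    simp [this]
  · rw [dif_neg (by tauto), if_neg h]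

theorem map_mkPt {S : Type*} [CommRing S] (f : R →+* S) (i : Fin 3 × Fin 3 × Fin p) :
    f (mkPt R p A B C D E G i) = mkPt S p (fun j => f (A j)) (fun j => f (B j))
      (fun j => f (C j)) (fun j => f (D j)) (fun j => f (E j)) (fun j => f (G j)) i := by
  obtain ⟨a, b, t⟩ := i
  fin_cases a <;> fin_cases b <;> simp [mkPt]

theorem P3v_33 (x x' : Fin 3 × Fin 3 × Fin p → R)
    (h : ∀ a b t, ¬(a = 2 ∧ b = 2) → x (a, b, t) = x' (a, b, t)) (ht' : t ≤ p) :
    P3v R 3 p x t = xvn R 3 p x 3 3 t + (P3v R 3 p x' t - xvn R 3 p x' 3 3 t) := by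
  have e : ∀ a b t, ¬(a = 3 ∧ b = 3) → xvn R 3 p x a b t = xvn R 3 p x' a b t := by
    intro a b t hab
    unfold xvn
    split_ifs with h'
    · apply h
      simp only [Fin.ext_iff]
      change ¬(a - 1 = 2 ∧ b - 1 = 2)
      omega
    · rfl
  unfold P3v
  rw [if_pos ht', if_pos ht']
  have e13 := fun t => e 1 3 t (by omega)
  have e12 := fun t => e 1 2 t (by omega)
  have e21 := fun t => e 2 1 t (by omega)
  have e22 := fun t => e 2 2 t (by omega)
  have e23 := fun t => e 2 3 t (by omega)
  have e31 := fun t => e 3 1 t (by omega)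
  have e32 := fun t => e 3 2 t (by omega)
  simp only [e13, e12, e21, e22, e23, e31, e32]
  ring

theorem P3v_mk (ht : 1 ≤ t) (ht' : t ≤ p) :
    P3v R 3 p (mkPt R p A B C D E G) t = G t + P3v R 3 p (mkPt R p A B C D E 0) t := by
  rw [P3v_33 t (mkPt R p A B C D E G) (mkPt R p A B C D E 0) ?_ ht']
  · have h1 := xvn_mk (p := p) A B C D E G t 2 2 (by omega) (by omega)
    have h2 := xvn_mk (p := p) A B C D E 0 t 2 2 (by omega) (by omega)
    rw [if_pos ⟨ht, ht'⟩] at h1 h2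
    have h1' : xvn R 3 p (mkPt R p A B C D E G) 3 3 t = G t := h1
    have h2' : xvn R 3 p (mkPt R p A B C D E 0) 3 3 t = 0 := h2
    rw [h1', h2', sub_zero]
  · intro a b t h
    fin_cases a <;> fin_cases b <;> simp [mkPt] at h ⊢

theorem mk_congr {A' B' C' D' E' G' : ℕ → R} (hA : ∀ t, 1 ≤ t → t ≤ p → A t = A' t)
    (hB : ∀ t, 1 ≤ t → t ≤ p → B t = B' t) (hC : ∀ t, 1 ≤ t → t ≤ p → C t = C' t)
    (hD : ∀ t, 1 ≤ t → t ≤ p → D t = D' t) (hE : ∀ t, 1 ≤ t → t ≤ p → E t = E' t)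
    (hG : ∀ t, 1 ≤ t → t ≤ p → G t = G' t) :
    mkPt R p A B C D E G = mkPt R p A' B' C' D' E' G' := by
  ext ⟨a, b, t⟩
  have h1 : 1 ≤ (t : ℕ) + 1 := by omega
  have h2 : (t : ℕ) + 1 ≤ p := by omega
  fin_cases a <;> fin_cases b <;> simp [mkPt, hA _ h1 h2, hB _ h1 h2, hC _ h1 h2, hD _ h1 h2,
    hE _ h1 h2, hG _ h1 h2]

theorem mk_self (x : Fin 3 × Fin 3 × Fin p → R) (hx : WZero R 3 p x) :
    x = mkPt R p (xvn R 3 p x 1 3) (xvn R 3 p x 2 3) (xvn R 3 p x 3 1) (xvn R 3 p x 3 2)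
      (xvn R 3 p x 2 1) (xvn R 3 p x 3 3) := by
  ext ⟨a, b, t⟩
  have h2 : (t : ℕ) + 1 ≤ p := by omega
  have := hx (t + 1) (by omega) h2
  fin_cases a <;> fin_cases b <;> simp [mkPt, xvn, h2] at this ⊢ <;> simp [this]
end mk

theorem core_rel {k : Type*} [CommRing k] {p s : ℕ} {x : Fin 3 × Fin 3 × Fin p → k}
    (hx : x ∈ W2s k 3 p s) (hs' : s ≤ p + 1) (I : ℕ) (hI : p + 1 ≤ I)
    (hI' : I ≤ 2 * p) :
    ∑ r ∈ Finset.Icc (I - p) p, (xvn k 3 p x 1 3 r * (xvn k 3 p x 3 1 (I - r) -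
      ∑ m ∈ Finset.Icc 1 (I - r - 1), xvn k 3 p x 2 1 m * xvn k 3 p x 3 2 (I - r - m)) +
      xvn k 3 p x 2 3 r * xvn k 3 p x 3 2 (I - r)) = 0 := by
  obtain ⟨hW, hP, h21, h32, -⟩ := hx
  have z12 : ∀ t, xvn k 3 p x 1 2 t = 0 := by
    intro t
    by_cases h : 1 ≤ t ∧ t ≤ p
    · exact (hW t h.1 h.2).2.1
    · unfold xvn; rw [dif_neg (by tauto)]
  have z22 : ∀ t, xvn k 3 p x 2 2 t = 0 := by
    intro t
    by_cases h : 1 ≤ t ∧ t ≤ p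
    · exact (hW t h.1 h.2).2.2
    · unfold xvn; rw [dif_neg (by tauto)]
  have z21 : ∀ t, s ≤ t → xvn k 3 p x 2 1 t = 0 := by
    intro t ht
    by_cases h : t ≤ p
    · exact h21 t ht h
    · unfold xvn; rw [dif_neg (by tauto)]
  have z32 : ∀ t, p + 2 - s ≤ t → xvn k 3 p x 3 2 t = 0 := by
    intro t ht
    by_cases h : t ≤ p
    · exact h32 t ht h
    · unfold xvn; rw [dif_neg (by tauto)]
  have h := hP I (by omega) hI'
  unfold P3v at h
  rw [if_neg (by omega)] at h
  simp only [mul_sub, Finset.mul_sum, ← mul_assoc]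
  have key : ∑ r ∈ Finset.Icc (I - p) p, ∑ m ∈ Finset.Icc 1 (I - r - 1), 
      xvn k 3 p x 1 3 r * xvn k 3 p x 2 1 m * xvn k 3 p x 3 2 (I - r - m) =
      ∑ r ∈ Finset.Icc (I - p) p, (xvn k 3 p x 1 3 r * xvn k 3 p x 3 1 (I - r) +
      xvn k 3 p x 2 3 r * xvn k 3 p x 3 2 (I - r)) := by
    split_ifs at h with h1
    · subst h1
      simp only [z12, z22, mul_zero, zero_mul, Finset.sum_const_zero, sub_zero, zero_add] at h
      have e : p + 1 - p = 1 := by omega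
      rw [e]
      rw [neg_add_eq_zero] at h
      rw [h]
      symm
      apply Finset.sum_subset_zero_on_sdiff (Finset.Icc_subset_Icc_right (by omega))
      · intro r hr
        simp only [Finset.mem_sdiff, Finset.mem_Icc] at hr
        have : r = p := by omega
        subst this
        simp
      · intro r hr
        have : p + 1 - r - 1 = p - r := by omega
        rw [this]
    · simp only [Tv, z12, z22, mul_zero, zero_mul, Finset.sum_const_zero, neg_zero, zero_add] at h
      rw [add_assoc, neg_add_eq_zero] at h
      rw [h]
      symm
      rw [add_eq_right]
      apply Finset.sum_eq_zero
      intro r hr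
      apply Finset.sum_eq_zero
      intro m hm
      simp only [Finset.mem_Icc] at hr hm
      by_cases hms : s ≤ m
      · rw [z21 m hms]; ring
      · rw [z32 _ (by omega)]; ring
  have e2 : ∀ r ∈ Finset.Icc (I - p) p, xvn k 3 p x 1 3 r * xvn k 3 p x 3 1 (I - r) -
      ∑ m ∈ Finset.Icc 1 (I - r - 1),
        xvn k 3 p x 1 3 r * xvn k 3 p x 2 1 m * xvn k 3 p x 3 2 (I - r - m) +
      xvn k 3 p x 2 3 r * xvn k 3 p x 3 2 (I - r) =
      (xvn k 3 p x 1 3 r * xvn k 3 p x 3 1 (I - r) +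
      xvn k 3 p x 2 3 r * xvn k 3 p x 3 2 (I - r)) - ∑ m ∈ Finset.Icc 1 (I - r - 1),
        xvn k 3 p x 1 3 r * xvn k 3 p x 2 1 m * xvn k 3 p x 3 2 (I - r - m) := by
    intros; ring
  rw [Finset.sum_congr rfl e2, Finset.sum_sub_distrib, key, sub_self]

/-- shift of a sequence -/
def sh {R : Type*} [CommRing R] (c : ℕ) (y : ℕ → R) (i : ℕ) : R := if i < c then 0 else y (i - c)

/-- convolution of sequences -/
def cv {R : Type*} [CommRing R] (u v : ℕ → R) (i : ℕ) : R :=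
  ∑ q ∈ Finset.HasAntidiagonal.antidiagonal i, u q.1 * v q.2

/-- coordinates 13 -/
def pA {R : Type*} [CommRing R] (p μ : ℕ) (y : Fin 6 → ℕ → R) (t : ℕ) : R := sh μ (y 0) (p - t)
/-- coordinates 32 -/
def pD {R : Type*} [CommRing R] (p μ M : ℕ) (y : Fin 6 → ℕ → R) (t : ℕ) : R :=
  sh μ (sh (M - μ) (y 1)) (p - t)
/-- coordinates 23 -/
def pB {R : Type*} [CommRing R] (p μ : ℕ) (y : Fin 6 → ℕ → R) (t : ℕ) : R :=
  -cv (y 2) (y 0) (p - t) + sh (p - μ) (y 3) (p - t)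
/-- coordinates 31 -/
def pC {R : Type*} [CommRing R] (p μ M : ℕ) (y : Fin 6 → ℕ → R) (t : ℕ) : R :=
  cv (y 2) (sh (M - μ) (y 1)) (p - t) + sh (p - μ) (y 4) (p - t) +
    ∑ r ∈ Finset.Icc 1 (t - 1), y 5 (r - 1) * pD p μ M y (t - r)
/-- coordinates 21 -/
def pE {R : Type*} [CommRing R] (y : Fin 6 → ℕ → R) (t : ℕ) : R := y 5 (t - 1)

/-- The parametrization. -/
def Phi (R : Type*) [CommRing R] (p μ M : ℕ) (y : Fin 6 → ℕ → R) : Fin 3 × Fin 3 × Fin p → R :=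
  mkPt R p (pA p μ y) (pB p μ y) (pC p μ M y) (pD p μ M y) (pE y)
    (fun t => - P3v R 3 p
      (mkPt R p (pA p μ y) (pB p μ y) (pC p μ M y) (pD p μ M y) (pE y) 0) t)

section nat
variable {R S : Type*} [CommRing R] [CommRing S] (f : R →+* S) (p μ M : ℕ) (y : Fin 6 → ℕ → R)

theorem map_sh (c : ℕ) (y : ℕ → R) (i : ℕ) : f (sh c y i) = sh c (fun j => f (y j)) i := by
  unfold sh; split_ifs <;> simp

theorem map_cv (u v : ℕ → R) (i : ℕ) :
    f (cv u v i) = cv (fun j => f (u j)) (fun j => f (v j)) i := by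
  simp [cv]

theorem map_Phi (i : Fin 3 × Fin 3 × Fin p) :
    f (Phi R p μ M y i) = Phi S p μ M (fun a j => f (y a j)) i := by
  unfold Phi
  have hA : (fun t => f (pA p μ y t)) = pA p μ (fun a j => f (y a j)) := by
    ext t; simp [pA, map_sh]
  have hB : (fun t => f (pB p μ y t)) = pB p μ (fun a j => f (y a j)) := by
    ext t; simp [pB, map_sh, map_cv]
  have hD' : ∀ t, f (pD p μ M y t) = pD p μ M (fun a j => f (y a j)) t := by
    intro t; simp [pD, map_sh]
  have hD : (fun t => f (pD p μ M y t)) = pD p μ M (fun a j => f (y a j)) := funext hD'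
  have hC : (fun t => f (pC p μ M y t)) = pC p μ M (fun a j => f (y a j)) := by
    ext t; simp [pC, map_sh, map_cv, hD']
  have hE : (fun t => f (pE y t)) = pE (fun a j => f (y a j)) := by
    ext t; simp [pE]
  rw [map_mkPt, hA, hB, hC, hD, hE]
  congr 1
  ext t
  rw [map_neg, map_P3v]
  congr 2
  ext i
  rw [map_mkPt, hA, hB, hC, hD, hE]
  congr 1
  ext t
  simp
end nat

open PowerSeries in
theorem ps_key {k : Type*} [Field k] {n : ℕ} {A B C D : PowerSeries k}
    (h0 : n = 0 ∨ constantCoeff A ≠ 0 ∨ constantCoeff D ≠ 0)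
    (h : (PowerSeries.X : PowerSeries k) ^ n ∣ A * C + B * D) :
    ∃ H, (PowerSeries.X : PowerSeries k) ^ n ∣ C - H * D ∧
      (PowerSeries.X : PowerSeries k) ^ n ∣ B + H * A := by
  rcases h0 with h0 | h0 | h0
  · exact ⟨0, by simp [h0], by simp [h0]⟩
  · have e := PowerSeries.mul_inv_cancel A h0
    refine ⟨-B * A⁻¹, ?_, ?_⟩
    · have : C - -B * A⁻¹ * D = A⁻¹ * (A * C + B * D) := by linear_combination (-C) * e
      rw [this]; exact Dvd.dvd.mul_left h _
    · have : B + -B * A⁻¹ * A = 0 := by linear_combination (-B) * e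
      rw [this]; exact dvd_zero _
  · have e := PowerSeries.mul_inv_cancel D h0
    refine ⟨C * D⁻¹, ?_, ?_⟩
    · have : C - C * D⁻¹ * D = 0 := by linear_combination (-C) * e
      rw [this]; exact dvd_zero _
    · have : B + C * D⁻¹ * A = D⁻¹ * (A * C + B * D) := by linear_combination (-B) * e
      rw [this]; exact Dvd.dvd.mul_left h _

theorem mk_shift {k : Type*} [Field k] (a : ℕ → k) (μ : ℕ) (ha : ∀ i < μ, a i = 0) :
    PowerSeries.mk a = PowerSeries.X ^ μ * PowerSeries.mk (fun j => a (j + μ)) := by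
  ext n
  rw [PowerSeries.coeff_X_pow_mul', PowerSeries.coeff_mk]
  split_ifs with h
  · rw [PowerSeries.coeff_mk]; congr 1; omega
  · exact ha n (by omega)

theorem fn_key {k : Type*} [Field k] {p μ : ℕ} (hμ : μ ≤ p) (a b c d : ℕ → k)
    (ha : ∀ i < μ, a i = 0) (hd : ∀ i < μ, d i = 0) (h0 : μ = p ∨ a μ ≠ 0 ∨ d μ ≠ 0)
    (h : ∀ j < p, ∑ q ∈ Finset.HasAntidiagonal.antidiagonal j, (a q.1 * c q.2 + b q.1 * d q.2) = 0) :
    ∃ H : ℕ → k, ∀ i < p - μ, c i = cv H (fun j => d (j + μ)) i ∧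
      b i = - cv H (fun j => a (j + μ)) i := by
  have hdvd : (PowerSeries.X : PowerSeries k) ^ (p - μ) ∣
      PowerSeries.mk (fun j => a (j + μ)) * PowerSeries.mk c +
      PowerSeries.mk b * PowerSeries.mk (fun j => d (j + μ)) := by
    have h1 : (PowerSeries.X : PowerSeries k) ^ p ∣ PowerSeries.mk a * PowerSeries.mk c +
      PowerSeries.mk b * PowerSeries.mk d := by
      rw [PowerSeries.X_pow_dvd_iff]
      intro m hm
      rw [map_add, PowerSeries.coeff_mul, PowerSeries.coeff_mul, ← Finset.sum_add_distrib]
      simpa using h m hm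
    rw [mk_shift a μ ha, mk_shift d μ hd] at h1
    have e : (PowerSeries.X : PowerSeries k) ^ p = PowerSeries.X ^ μ * PowerSeries.X ^ (p - μ) := by
      rw [← pow_add]; congr 1; omega
    rw [e] at h1
    refine (mul_dvd_mul_iff_left (pow_ne_zero μ PowerSeries.X_ne_zero)).1 (h1.trans (dvd_of_eq ?_))
    ring
  obtain ⟨H, h1, h2⟩ := ps_key (n := p - μ) (by
    rcases h0 with h0 | h0 | h0
    · left; omega
    · right; left; simpa using h0
    · right; right; simpa using h0) hdvd
  rw [PowerSeries.X_pow_dvd_iff] at h1 h2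
  refine ⟨fun n => PowerSeries.coeff n H, fun i hi => ⟨?_, ?_⟩⟩
  · have := h1 i hi
    rw [map_sub, PowerSeries.coeff_mul] at this
    simpa [cv] using sub_eq_zero.1 this
  · have := h2 i hi
    rw [map_add, PowerSeries.coeff_mul] at this
    simpa [cv] using eq_neg_of_add_eq_zero_left this

/-- Numbers of parameters. -/
def nn (p m μ : ℕ) : Fin 6 → ℕ := ![p - μ, p - max m μ, p - μ, μ, μ, m]

theorem exists_param {k : Type*} [Field k] {p s : ℕ} {x : Fin 3 × Fin 3 × Fin p → k}
    (hs : 2 ≤ s) (hs' : s ≤ p + 1) (hx : x ∈ W2s k 3 p s) :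
    ∃ μ ≤ p, ∃ y : Fin 6 → ℕ → k, (∀ i j, nn p (s - 1) μ i ≤ j → y i j = 0) ∧
      x = Phi k p μ (max (s - 1) μ) y := by
  set a : ℕ → k := fun i => xvn k 3 p x 1 3 (p - i) with ha_def
  set b : ℕ → k := fun i => xvn k 3 p x 2 3 (p - i) with hb_def
  set d : ℕ → k := fun i => xvn k 3 p x 3 2 (p - i) with hd_def
  set e : ℕ → k := fun j => xvn k 3 p x 2 1 (j + 1) with he_def
  set c : ℕ → k := fun i => xvn k 3 p x 3 1 (p - i) -
    ∑ m ∈ Finset.Icc 1 (p - i - 1), xvn k 3 p x 2 1 m * xvn k 3 p x 3 2 (p - i - m) with hc_def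
  have z0 : ∀ a b t, (t = 0 ∨ p < t) → xvn k 3 p x a b t = 0 := by
    intro a b t ht
    unfold xvn; rw [dif_neg (by omega)]
  have hap : ∀ i, p ≤ i → a i = 0 := fun i hi => z0 _ _ _ (by omega)
  have hdp : ∀ i, p ≤ i → d i = 0 := fun i hi => z0 _ _ _ (by omega)
  have hdm : ∀ i, i < s - 1 → d i = 0 := by
    intro i hi
    exact hx.2.2.2.1 _ (by omega) (by omega)
  have hem : ∀ j, s - 1 ≤ j → e j = 0 := by
    intro j hj
    by_cases h : j + 1 ≤ p
    · exact hx.2.2.1 _ (by omega) h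
    · exact z0 _ _ _ (by omega)
  have hrel : ∀ j < p, ∑ q ∈ Finset.HasAntidiagonal.antidiagonal j, (a q.1 * c q.2 + b q.1 * d q.2) = 0 := by
    intro j hj
    rw [← core_rel hx hs' (2 * p - j) (by omega) (by omega)]
    refine Finset.sum_nbij' (fun q => p - q.1) (fun r => (p - r, j - (p - r))) ?_ ?_ ?_ ?_ ?_
    · rintro ⟨u, v⟩ hq
      simp only [Finset.HasAntidiagonal.mem_antidiagonal, Finset.mem_Icc] at hq ⊢
      omega
    · intro r hr
      simp only [Finset.HasAntidiagonal.mem_antidiagonal, Finset.mem_Icc] at hr ⊢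
      omega
    · rintro ⟨u, v⟩ hq
      simp only [Finset.HasAntidiagonal.mem_antidiagonal, Prod.mk.injEq] at hq ⊢
      omega
    · intro r hr
      simp only [Finset.mem_Icc] at hr
      change p - (p - r) = r
      omega
    · rintro ⟨u, v⟩ hq
      simp only [Finset.HasAntidiagonal.mem_antidiagonal] at hq
      have e1 : 2 * p - j - (p - u) = p - v := by omega
      simp only [ha_def, hb_def, hc_def, hd_def, e1]
  obtain ⟨μ, hμ, haμ, hdμ, h0⟩ : ∃ μ ≤ p, (∀ i < μ, a i = 0) ∧ (∀ i < μ, d i = 0) ∧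
      (μ = p ∨ a μ ≠ 0 ∨ d μ ≠ 0) := by
    have hex : ∃ μ, μ = p ∨ a μ ≠ 0 ∨ d μ ≠ 0 := ⟨p, Or.inl rfl⟩
    refine ⟨Nat.find hex, Nat.find_min' hex (Or.inl rfl), ?_, ?_, Nat.find_spec hex⟩
    · intro i hi
      have := Nat.find_min hex hi
      push Not at this
      exact this.2.1
    · intro i hi
      have := Nat.find_min hex hi
      push Not at this
      exact this.2.2
  obtain ⟨H, hH⟩ := fn_key hμ a b c d haμ hdμ h0 hrel
  set M := max (s - 1) μ with hM
  set h : ℕ → k := fun j => if j < p - μ then H j else 0 with hh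
  set y0 : ℕ → k := fun j => a (j + μ) with hy0
  set y1 : ℕ → k := fun j => d (j + M) with hy1
  set d' : ℕ → k := fun j => d (j + μ) with hd'
  have hcv : ∀ (v : ℕ → k) i, i < p - μ → cv h v i = cv H v i := by
    intro v i hi
    refine Finset.sum_congr rfl fun q hq => ?_
    rw [Finset.HasAntidiagonal.mem_antidiagonal] at hq
    rw [hh]
    simp only
    rw [if_pos (by omega)]
  have hsd : sh (M - μ) y1 = d' := by
    ext i
    unfold sh
    split_ifs with hi
    · exact (hdm _ (by omega)).symm
    · simp only [hy1, hd']; congr 1; omega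
  have hsd2 : sh μ d' = d := by
    ext i
    unfold sh
    split_ifs with hi
    · exact (hdμ _ (by omega)).symm
    · simp only [hd']; congr 1; omega
  have hsa : sh μ y0 = a := by
    ext i
    unfold sh
    split_ifs with hi
    · exact (haμ _ (by omega)).symm
    · simp only [hy0]; congr 1; omega
  set y3 : ℕ → k := fun j => if j < μ then b (j + (p - μ)) + cv h y0 (j + (p - μ)) else 0 with hy3
  set y4 : ℕ → k := fun j => if j < μ then c (j + (p - μ)) - cv h d' (j + (p - μ)) else 0 with hy4
  have hb : ∀ i < p, b i = -cv h y0 i + sh (p - μ) y3 i := by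
    intro i hi
    unfold sh
    split_ifs with hi'
    · rw [hcv _ _ hi', (hH i hi').2, add_zero]
    · simp only [hy3]
      rw [if_pos (by omega), show i - (p - μ) + (p - μ) = i by omega]
      ring
  have hc : ∀ i < p, c i = cv h d' i + sh (p - μ) y4 i := by
    intro i hi
    unfold sh
    split_ifs with hi'
    · rw [hcv _ _ hi', (hH i hi').1, add_zero]
    · simp only [hy4]
      rw [if_pos (by omega), show i - (p - μ) + (p - μ) = i by omega]
      ring
  obtain ⟨y, hy⟩ : ∃ y : Fin 6 → ℕ → k, y = ![y0, y1, h, y3, y4, e] := ⟨_, rfl⟩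
  have Y0 : y 0 = y0 := by rw [hy]; rfl
  have Y1 : y 1 = y1 := by rw [hy]; rfl
  have Y2 : y 2 = h := by rw [hy]; rfl
  have Y3 : y 3 = y3 := by rw [hy]; rfl
  have Y4 : y 4 = y4 := by rw [hy]; rfl
  have Y5 : y 5 = e := by rw [hy]; rfl
  have tt : ∀ t, t ≤ p → p - (p - t) = t := fun t ht => by omega
  have EA : ∀ t, 1 ≤ t → t ≤ p → xvn k 3 p x 1 3 t = pA p μ y t := by
    intro t _ ht
    simp only [pA, Y0, hsa, ha_def, tt t ht]
  have ED : ∀ t, 1 ≤ t → t ≤ p → xvn k 3 p x 3 2 t = pD p μ M y t := by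
    intro t _ ht
    simp only [pD, Y1, hsd, hsd2, hd_def, tt t ht]
  have EB : ∀ t, 1 ≤ t → t ≤ p → xvn k 3 p x 2 3 t = pB p μ y t := by
    intro t ht1 ht
    simp only [pB, Y2, Y0, Y3]
    rw [← hb (p - t) (by omega)]
    simp only [hb_def, tt t ht]
  have EE : ∀ t, 1 ≤ t → t ≤ p → xvn k 3 p x 2 1 t = pE y t := by
    intro t ht1 ht
    simp only [pE, Y5, he_def]
    congr 1; omega
  have EC : ∀ t, 1 ≤ t → t ≤ p → xvn k 3 p x 3 1 t = pC p μ M y t := by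
    intro t ht1 ht
    have : ∑ r ∈ Finset.Icc 1 (t - 1), y 5 (r - 1) * pD p μ M y (t - r) =
        ∑ r ∈ Finset.Icc 1 (t - 1), xvn k 3 p x 2 1 r * xvn k 3 p x 3 2 (t - r) := by
      refine Finset.sum_congr rfl fun r hr => ?_
      rw [Finset.mem_Icc] at hr
      rw [EE r (by omega) (by omega), ED (t - r) (by omega) (by omega)]
      rfl
    simp only [pC, this, Y2, Y1, Y4, hsd]
    rw [← hc (p - t) (by omega)]
    simp only [hc_def, tt t ht]
    ring
  refine ⟨μ, hμ, y, ?_, ?_⟩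
  · intro i j hij
    fin_cases i
    · change y 0 j = 0
      change p - μ ≤ j at hij
      rw [Y0]; exact hap _ (by omega)
    · change y 1 j = 0
      change p - M ≤ j at hij
      rw [Y1]; exact hdp _ (by omega)
    · change y 2 j = 0
      change p - μ ≤ j at hij
      rw [Y2]; exact if_neg (by omega)
    · change y 3 j = 0
      change μ ≤ j at hij
      rw [Y3]; exact if_neg (by omega)
    · change y 4 j = 0
      change μ ≤ j at hij
      rw [Y4]; exact if_neg (by omega)
    · change y 5 j = 0
      change s - 1 ≤ j at hij
      rw [Y5]; exact hem _ hij
  · have hself := mk_self x hx.1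
    have e0 : mkPt k p (xvn k 3 p x 1 3) (xvn k 3 p x 2 3) (xvn k 3 p x 3 1) (xvn k 3 p x 3 2)
        (xvn k 3 p x 2 1) 0 = mkPt k p (pA p μ y) (pB p μ y) (pC p μ M y) (pD p μ M y) (pE y) 0 :=
      mk_congr _ _ _ _ _ _ EA EB EC ED EE (fun _ _ _ => rfl)
    refine hself.trans (mk_congr _ _ _ _ _ _ EA EB EC ED EE ?_)
    intro t ht1 ht
    have h1 := P3v_mk (p := p) (xvn k 3 p x 1 3) (xvn k 3 p x 2 3) (xvn k 3 p x 3 1)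
      (xvn k 3 p x 3 2) (xvn k 3 p x 2 1) (xvn k 3 p x 3 3) t ht1 ht
    rw [← hself, hx.2.1 t ht1 (by omega), e0] at h1
    exact eq_neg_of_add_eq_zero_left h1.symm

/-- Generic parameters. -/
def ygen (k : Type*) [Field k] (n : Fin 6 → ℕ) :
    Fin 6 → ℕ → MvPolynomial (Σ i : Fin 6, Fin (n i)) k :=
  fun i j => if h : j < n i then X ⟨i, ⟨j, h⟩⟩ else 0

/-- The parametrization as an algebra map. -/
def phiMap (k : Type*) [Field k] (p m μ : ℕ) :
    MvPolynomial (Fin 3 × Fin 3 × Fin p) k →ₐ[k]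
      MvPolynomial (Σ i : Fin 6, Fin (nn p m μ i)) k :=
  aeval (Phi _ p μ (max m μ) (ygen k (nn p m μ)))

theorem mem_ker {k : Type*} [Field k] {p m μ : ℕ} (y : Fin 6 → ℕ → k)
    (hy : ∀ i j, nn p m μ i ≤ j → y i j = 0) :
    Phi k p μ (max m μ) y ∈ zeroLocus k (RingHom.ker (phiMap k p m μ)) := by
  intro f hf
  let g : MvPolynomial (Σ i : Fin 6, Fin (nn p m μ i)) k →ₐ[k] k := aeval (fun q => y q.1 q.2)
  have hcomp : g.comp (phiMap k p m μ) = aeval (Phi k p μ (max m μ) y) := by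
    ext i
    have h1 := map_Phi g.toRingHom p μ (max m μ) (ygen k (nn p m μ)) i
    simp only [AlgHom.comp_apply, phiMap, aeval_X]
    refine Eq.trans h1 ?_
    congr 1
    ext a j
    simp only [ygen]
    split_ifs with h
    · simp [g]
    · simp [hy a j (by omega)]
  rw [← hcomp, AlgHom.comp_apply, (RingHom.mem_ker).1 hf, map_zero]

theorem card_nn {p m μ : ℕ} (hm : m ≤ p) (hμ : μ ≤ p) :
    Fintype.card (Σ i : Fin 6, Fin (nn p m μ i)) ≤ 3 * p := by
  rw [Fintype.card_sigma]
  simp only [Fintype.card_fin]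
  simp [Fin.sum_univ_succ, nn]
  omega

end Part3

/-- For `Y_p(gl_3)` with `p > 2`, the subvariety `W₂ = ⋃_{s=2}^{p+1} W_{2s}` of `GTs₁`
is equidimensional of dimension `3p`. -/
theorem W2_equidim (k : Type*) [Field k] [IsAlgClosed k] [CharZero k]
    (p : ℕ) (hp : 2 < p) :
    IsEquidimOfDim k (Fin 3 × Fin 3 × Fin p) (W2 k 3 p) (3 * p) := by
  have hW : W2 k 3 p = ⋃ s ∈ Finset.Icc 2 (p + 1), W2s k 3 p s := by
    unfold W2
    simp only [Set.mem_Icc, Finset.mem_Icc]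
  rw [hW]
  refine equidim_of (Finset.Icc 2 (p + 1)) (3 * p) (fun s => W2s k 3 p s) (EqIdx p)
    (fun s => eqW k p s) ?_ ?_ ?_
  · intro s hs
    rw [Finset.mem_Icc] at hs
    exact W2s_eq k p s hs.1 hs.2
  · intro s hs
    rw [Finset.mem_Icc] at hs
    simp only [Fintype.card_sum, Fintype.card_prod, Fintype.card_fin]
    omega
  · intro s hs
    rw [Finset.mem_Icc] at hs
    refine ⟨(Finset.range (p + 1)).image (fun μ => RingHom.ker (phiMap k p (s - 1) μ)), ?_, ?_⟩
    · intro x hx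
      obtain ⟨μ, hμ, y, hy, rfl⟩ := exists_param hs.1 hs.2 hx
      exact ⟨_, Finset.mem_image_of_mem _ (Finset.mem_range.2 (by omega)), mem_ker y hy⟩
    · intro I hI
      obtain ⟨μ, hμ, rfl⟩ := Finset.mem_image.1 hI
      rw [Finset.mem_range] at hμ
      refine (dim_image (phiMap k p (s - 1) μ)).trans ?_
      have := card_nn (p := p) (m := s - 1) (μ := μ) (by omega) (by omega)
      exact_mod_cast this

end
end
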